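/- arXiv:2211.08145 — 2 statements merged into one kernel-verified Lean document; each statement's English description precedes it below -/
import Mathlib

section
/- Let G be a countable group. Then G has the strong topological Rokhlin property if and only if for every finite set A with at least two elements the projectively isolated subshifts are dense in the space of subshifts of A^G; that is, for every subshift X ⊆ A^G and every finite set F ⊆ G there exists a projectively isolated subshift X' ⊆ A^G with X'_F = X_F. -/
open Topology

/-- The Cantor space `𝒞`. -/
abbrev Cantor : Type := ℕ → Bool

/-- `α : G → C(𝒞,𝒞)` is a continuous action if it is a homomorphism into the
self-homeomorphisms of `𝒞` (recorded as continuous maps; continuity of the inverse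
`α g⁻¹` is automatic from the homomorphism equations). -/
def IsAction (G : Type) [Group G] (α : G → C(Cantor, Cantor)) : Prop :=
  α 1 = ContinuousMap.id Cantor ∧ ∀ g h : G, α (g * h) = (α g).comp (α h)

/-- The space `Act_G(𝒞)` of continuous actions of `G` on the Cantor space,
topologized as a subspace of `C(𝒞,𝒞)^G` (compact-open topology on each factor). -/
abbrev ActSpace (G : Type) [Group G] : Type :=
  {α : G → C(Cantor, Cantor) // IsAction G α}

/-- The conjugacy class of an action `α` under the conjugation action of `Homeo(𝒞)`. -/
def conjClass {G : Type} [Group G] (α : ActSpace G) : Set (ActSpace G) :=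
  {β | ∃ φ : Cantor ≃ₜ Cantor, ∀ g : G,
    (β.1 g : Cantor → Cantor) = φ ∘ (α.1 g : Cantor → Cantor) ∘ φ.symm}

/-- The strong topological Rokhlin property: some action on the Cantor space has a
comeager conjugacy class. -/
def HasSTRP (G : Type) [Group G] : Prop :=
  ∃ α : ActSpace G, conjClass α ∈ residual (ActSpace G)

/-- The shift action of `G` on `A^G`: `(g • x)(h) = x(g⁻¹h)`. -/
def shift {G : Type} [Group G] {A : Type} (g : G) (x : G → A) : G → A :=
  fun h => x (g⁻¹ * h)

/-- A subshift: closed (in the product of discrete topologies) and shift-invariant. -/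
def IsSubshift (G : Type) [Group G] (A : Type) (X : Set (G → A)) : Prop :=
  (letI : TopologicalSpace A := ⊥; IsClosed X) ∧ ∀ g : G, ∀ x ∈ X, shift g x ∈ X

/-- The set `X_F` of `F`-patterns of `X`. -/
def patterns {G A : Type} (F : Finset G) (X : Set (G → A)) : Set (F → A) :=
  (fun (x : G → A) (f : F) => x (f : G)) '' X

/-- Subshift of finite type, with defining window `E` and allowed patterns `𝔽`. -/
def IsSFT (G : Type) [Group G] (A : Type) (X : Set (G → A)) : Prop :=
  ∃ (E : Finset G) (𝔽 : Set (E → A)),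
    ∀ x : G → A, x ∈ X ↔ ∀ g : G, (fun e : E => shift g x (e : G)) ∈ 𝔽

/-- Continuity on a set, for a map between full shift spaces over discrete alphabets. -/
def ContinuousOnD {G A B : Type} (ψ : (G → B) → (G → A)) (Z : Set (G → B)) : Prop :=
  letI : TopologicalSpace A := ⊥
  letI : TopologicalSpace B := ⊥
  ContinuousOn ψ Z

/-- `G`-equivariance of a map between shift spaces, on a set. -/
def EquivariantOn {G A B : Type} [Group G] (ψ : (G → B) → (G → A)) (Z : Set (G → B)) : Prop :=
  ∀ g : G, ∀ z ∈ Z, ψ (shift g z) = shift g (ψ z)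

/-- A sofic subshift: a continuous `G`-equivariant image of a subshift of finite type. -/
def IsSofic (G : Type) [Group G] (A : Type) (X : Set (G → A)) : Prop :=
  ∃ (B : Type) (_ : Fintype B) (_ : Nontrivial B) (Z : Set (G → B))
    (ψ : (G → B) → (G → A)),
    IsSubshift G B Z ∧ IsSFT G B Z ∧ ContinuousOnD ψ Z ∧ EquivariantOn ψ Z ∧ ψ '' Z = X

/-- The sliding block code `Φ(y)(g) = f(d ↦ y(g·d))` induced by `f : (D → B) → A`. -/
def slidingBlock {G : Type} [Group G] {A B : Type} (D : Finset G)
    (f : (D → B) → A) : (G → B) → (G → A) :=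
  fun y g => f (fun d => y (g * (d : G)))

/-- A projectively isolated subshift. -/
def ProjIsolated (G : Type) [Group G] (A : Type) (X : Set (G → A)) : Prop :=
  ∃ (B : Type) (_ : Fintype B) (_ : Nontrivial B) (Y : Set (G → B))
    (F D : Finset G) (f : (D → B) → A),
    IsSubshift G B Y ∧
    slidingBlock D f '' Y = X ∧
    ∀ Z : Set (G → B), IsSubshift G B Z → patterns F Z = patterns F Y →
      slidingBlock D f '' Z = X

/-- An isolated subshift: an SFT `X` such that for some finite `F ⊆ G` no proper
subshift has the same `F`-patterns as `X`. -/
def IsIsolated (G : Type) [Group G] (A : Type) (X : Set (G → A)) : Prop :=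
  IsSFT G A X ∧ ∃ F : Finset G, ∀ Y : Set (G → A),
    IsSubshift G A Y → Y ⊂ X → patterns F Y ≠ patterns F X

/-- A strongly projectively isolated subshift: a continuous `G`-equivariant image of an
isolated subshift. -/
def StronglyProjIsolated (G : Type) [Group G] (A : Type) (X : Set (G → A)) : Prop :=
  ∃ (B : Type) (_ : Fintype B) (_ : Nontrivial B) (Y : Set (G → B))
    (ψ : (G → B) → (G → A)),
    IsSubshift G B Y ∧ IsIsolated G B Y ∧
    ContinuousOnD ψ Y ∧ EquivariantOn ψ Y ∧ ψ '' Y = X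

/-- Shadowing (the pseudo-orbit tracing property) of an action `act` of `G`,
with respect to a distance function `d`. -/
def HasShadowing {G X : Type} [Group G] (d : X → X → ℝ) (act : G → X → X) : Prop :=
  ∀ ε : ℝ, 0 < ε → ∃ (δ : ℝ) (S : Finset G), 0 < δ ∧
    ∀ x : G → X, (∀ g : G, ∀ s ∈ S, d (act s (x g)) (x (s * g)) < δ) →
      ∃ y : X, ∀ g : G, d (x g) (act g y) < ε

/-- A finite partition of the whole space into nonempty clopen sets. -/
def IsClopenPartition {X : Type} [TopologicalSpace X] (parts : Finset (Set X)) : Prop :=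
  (∀ P ∈ parts, IsClopen P ∧ P.Nonempty) ∧
  (∀ P ∈ parts, ∀ Q ∈ parts, P ≠ Q → Disjoint P Q) ∧
  (⋃ P ∈ parts, P) = Set.univ

/-- A finite partition of a subshift `X` into nonempty subsets that are clopen in `X`. -/
def IsClopenPartitionIn {G A : Type} (X : Set (G → A)) (parts : Finset (Set (G → A))) : Prop :=
  (letI : TopologicalSpace A := ⊥;
    ∀ P ∈ parts, P.Nonempty ∧ P ⊆ X ∧ IsClopen (Subtype.val ⁻¹' P : Set X)) ∧
  (∀ P ∈ parts, ∀ Q ∈ parts, P ≠ Q → Disjoint P Q) ∧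
  (⋃ P ∈ parts, P) = X

/-- `X` is `fam`-minimal: no nonempty proper subshift of `X` meets every member of `fam`. -/
def AMinimal {G A : Type} [Group G] (X : Set (G → A)) (fam : Set (Set (G → A))) : Prop :=
  ¬ ∃ Y : Set (G → A), IsSubshift G A Y ∧ Y.Nonempty ∧ Y ⊂ X ∧
    ∀ S ∈ fam, (Y ∩ S).Nonempty

/-- The free product of a subshift `V ⊆ B^G` and a subshift `W ⊆ B^H`, a subshift
of `B^(G∗H)`. -/
def freeProd {G H B : Type} [Group G] [Group H]
    (V : Set (G → B)) (W : Set (H → B)) : Set (Monoid.Coprod G H → B) :=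
  {x | ∀ g : Monoid.Coprod G H,
    (fun h : G => x (g * Monoid.Coprod.inl h)) ∈ V ∧
    (fun k : H => x (g * Monoid.Coprod.inr k)) ∈ W}

/-! ### Itineraries and the back-and-forth construction -/

/-- The itinerary map `x ↦ (g ↦ p (a g⁻¹ x))` of a family of self-maps with respect to `p`. -/
def itin {G C K : Type} [Group G] [TopologicalSpace C] [TopologicalSpace K]
    (a : G → C(C, C)) (p : C(C, K)) (x : C) : G → K :=
  fun g => p (a g⁻¹ x)

/-- Homomorphisms from `G` to the self-homeomorphisms of an arbitrary space. -/
def IsAct {G C : Type} [Group G] [TopologicalSpace C] (a : G → C(C, C)) : Prop :=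
  a 1 = ContinuousMap.id C ∧ ∀ g h : G, a (g * h) = (a g).comp (a h)

/-- Countably many continuous `ℕ`-valued functions separate the points of `C`. -/
def CountablySeparated (C : Type) [TopologicalSpace C] : Prop :=
  ∃ b : ℕ → C(C, ℕ), ∀ x y, (∀ n, b n x = b n y) → x = y

theorem continuous_itin {G C K : Type} [Group G] [TopologicalSpace C] [TopologicalSpace K]
    (a : G → C(C, C)) (p : C(C, K)) : Continuous (itin a p) :=
  continuous_pi fun g => p.continuous.comp (a g⁻¹).continuous

theorem itin_one {G C K : Type} [Group G] [TopologicalSpace C] [TopologicalSpace K]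
    {a : G → C(C, C)} (ha : IsAct a) (p : C(C, K)) (x : C) : itin a p x 1 = p x := by
  simp [itin, ha.1]

theorem shift_itin {G C K : Type} [Group G] [TopologicalSpace C] [TopologicalSpace K]
    {a : G → C(C, C)} (ha : IsAct a) (p : C(C, K)) (g : G) (x : C) :
    shift g (itin a p x) = itin a p (a g x) := by
  funext h
  have := congrArg (fun f : C(C, C) => p (f x)) (ha.2 h⁻¹ g)
  simpa [shift, itin] using this

theorem exists_itin_match {G C C' : Type} [Group G] [TopologicalSpace C] [TopologicalSpace C']
    [CompactSpace C'] (a : G → C(C, C)) (a' : G → C(C', C'))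
    (q : ℕ → C(C, ℕ)) (q' : ℕ → C(C', ℕ))
    (hR : ∀ n, Set.range (itin a (q n)) = Set.range (itin a' (q' n)))
    (hi : ∀ n, ∃ i : ℕ → ℕ, (∀ x, q n x = i (q (n + 1) x)) ∧ ∀ y, q' n y = i (q' (n + 1) y))
    (x : C) : ∃ y, ∀ n, itin a (q n) x = itin a' (q' n) y := by
  have hcl : ∀ n, IsClosed {y | itin a (q n) x = itin a' (q' n) y} := fun n =>
    isClosed_eq continuous_const (continuous_itin a' (q' n))
  have h := IsCompact.nonempty_iInter_of_sequence_nonempty_isCompact_isClosed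
    (fun n => {y | itin a (q n) x = itin a' (q' n) y}) ?_ ?_ (hcl 0).isCompact hcl
  · obtain ⟨y, hy⟩ := h
    exact ⟨y, fun n => Set.mem_iInter.1 hy n⟩
  · intro n y hy
    obtain ⟨i, h1, h2⟩ := hi n
    funext g
    have := congrFun (show itin a (q (n + 1)) x = itin a' (q' (n + 1)) y from hy) g
    simp only [itin] at this ⊢
    rw [h1, h2, this]
  · intro n
    have : itin a (q n) x ∈ Set.range (itin a' (q' n)) := hR n ▸ Set.mem_range_self x
    obtain ⟨y, hy⟩ := this
    exact ⟨y, hy.symm⟩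

theorem continuous_of_countablySeparating {C C' : Type} [TopologicalSpace C]
    [TopologicalSpace C'] [CompactSpace C'] (b : ℕ → C(C', ℕ))
    (hb : ∀ x y, (∀ n, b n x = b n y) → x = y) (f : C → C')
    (hf : ∀ n, Continuous fun x => b n (f x)) : Continuous f := by
  have hc : Continuous (fun (x : C') (n : ℕ) => b n x) := continuous_pi fun n => (b n).continuous
  have hinj : Function.Injective (fun (x : C') (n : ℕ) => b n x) := fun x y h =>
    hb x y fun n => congrFun h n
  exact (hc.isClosedEmbedding hinj).isInducing.continuous_iff.2 (continuous_pi hf)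

theorem exists_homeomorph_of_matching {G C C' : Type} [Group G] [TopologicalSpace C]
    [TopologicalSpace C'] [CompactSpace C] [CompactSpace C'] [T2Space C']
    {a : G → C(C, C)} {a' : G → C(C', C')} (ha : IsAct a) (ha' : IsAct a')
    (b : ℕ → C(C, ℕ)) (hb : ∀ x y, (∀ n, b n x = b n y) → x = y)
    (b' : ℕ → C(C', ℕ)) (hb' : ∀ x y, (∀ n, b' n x = b' n y) → x = y)
    (q : ℕ → C(C, ℕ)) (q' : ℕ → C(C', ℕ))
    (hR : ∀ n, Set.range (itin a (q n)) = Set.range (itin a' (q' n)))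
    (hi : ∀ n, ∃ i : ℕ → ℕ, (∀ x, q n x = i (q (n + 1) x)) ∧ ∀ y, q' n y = i (q' (n + 1) y))
    (hj : ∀ n, ∃ j : ℕ → ℕ, ∀ x, b n x = j (q (n + 1) x))
    (hj' : ∀ n, ∃ j : ℕ → ℕ, ∀ y, b' n y = j (q' (n + 1) y)) :
    ∃ φ : C ≃ₜ C', (∀ g x, φ (a g x) = a' g (φ x)) ∧ ∀ n x, q' n (φ x) = q n x := by
  choose f hf using exists_itin_match a a' q q' hR hi
  choose f' hf' using exists_itin_match a' a q' q (fun n => (hR n).symm)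
    (fun n => let ⟨i, h1, h2⟩ := hi n; ⟨i, h2, h1⟩)
  have hfq : ∀ n x, q' n (f x) = q n x := fun n x => by
    have := congrFun (hf x n) 1
    rwa [itin_one ha, itin_one ha', eq_comm] at this
  have hfq' : ∀ n y, q n (f' y) = q' n y := fun n y => by
    have := congrFun (hf' y n) 1
    rwa [itin_one ha, itin_one ha', eq_comm] at this
  have huniq : ∀ x y, (∀ n, q n x = q n y) → x = y := fun x y h => hb x y fun n => by
    obtain ⟨j, hj⟩ := hj n
    rw [hj, hj, h]
  have huniq' : ∀ x y, (∀ n, q' n x = q' n y) → x = y := fun x y h => hb' x y fun n => by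
    obtain ⟨j, hj⟩ := hj' n
    rw [hj, hj, h]
  let e : C ≃ C' :=
    { toFun := f
      invFun := f'
      left_inv := fun x => huniq _ _ fun n => by rw [hfq', hfq]
      right_inv := fun y => huniq' _ _ fun n => by rw [hfq, hfq'] }
  have hcont : Continuous e := continuous_of_countablySeparating b' hb' f fun n => by
    obtain ⟨j, hj⟩ := hj' n
    simp only [hj, hfq]
    exact continuous_of_discreteTopology.comp (q (n + 1)).continuous
  refine ⟨hcont.homeoOfEquivCompactToT2, fun g x => ?_, hfq⟩
  change f (a g x) = a' g (f x)
  refine huniq' _ _ fun n => ?_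
  rw [hfq]
  have h1 := congrFun (hf x n) g⁻¹
  simpa [itin] using h1

/-- The continuous function `x ↦ ⟨q x, p x⟩` coded by a natural number. -/
def natPair {C : Type} [TopologicalSpace C] (q p : C(C, ℕ)) : C(C, ℕ) :=
  ⟨fun x => Nat.pair (q x) (p x), (continuous_of_discreteTopology
    (f := fun z : ℕ × ℕ => Nat.pair z.1 z.2)).comp (q.continuous.prodMk p.continuous)⟩

theorem range_itin_comp {G C K L : Type} [Group G] [TopologicalSpace C] [TopologicalSpace K]
    [TopologicalSpace L] (a : G → C(C, C)) (p : C(C, K)) (p' : C(C, L)) (i : K → L)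
    (h : ∀ x, p' x = i (p x)) :
    Set.range (itin a p') = (fun z : G → K => i ∘ z) '' Set.range (itin a p) := by
  rw [← Set.range_comp]
  congr 1
  funext x g
  simp [itin, h]

/-- If partial matchings of itineraries can always be extended on both sides, then every
partial matching is induced by an equivariant homeomorphism. -/
theorem exists_homeomorph_of_extension {G C C' : Type} [Group G] [TopologicalSpace C]
    [TopologicalSpace C'] [CompactSpace C] [CompactSpace C'] [T2Space C']
    {a : G → C(C, C)} {a' : G → C(C', C')} (ha : IsAct a) (ha' : IsAct a')
    (hC : CountablySeparated C) (hC' : CountablySeparated C')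
    (ext : ∀ (q : C(C, ℕ)) (q' : C(C', ℕ)), Set.range (itin a q) = Set.range (itin a' q') →
      ∀ p : C(C, ℕ), ∃ p' : C(C', ℕ),
        Set.range (itin a (q.prodMk p)) = Set.range (itin a' (q'.prodMk p')))
    (ext' : ∀ (q' : C(C', ℕ)) (q : C(C, ℕ)), Set.range (itin a' q') = Set.range (itin a q) →
      ∀ p' : C(C', ℕ), ∃ p : C(C, ℕ),
        Set.range (itin a' (q'.prodMk p')) = Set.range (itin a (q.prodMk p)))
    (q : C(C, ℕ)) (q' : C(C', ℕ)) (hq : Set.range (itin a q) = Set.range (itin a' q')) :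
    ∃ φ : C ≃ₜ C', (∀ g x, φ (a g x) = a' g (φ x)) ∧ ∀ x, q' (φ x) = q x := by
  obtain ⟨b, hb⟩ := hC
  obtain ⟨b', hb'⟩ := hC'
  have pairR : ∀ (q p : C(C, ℕ)) (q' p' : C(C', ℕ)),
      Set.range (itin a (q.prodMk p)) = Set.range (itin a' (q'.prodMk p')) →
      Set.range (itin a (natPair q p)) = Set.range (itin a' (natPair q' p')) := by
    intro q p q' p' h
    rw [range_itin_comp a (q.prodMk p) (natPair q p) (fun z => Nat.pair z.1 z.2) fun _ => rfl,
      range_itin_comp a' (q'.prodMk p') (natPair q' p') (fun z => Nat.pair z.1 z.2) fun _ => rfl, h]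
  let S := {s : C(C, ℕ) × C(C', ℕ) // Set.range (itin a s.1) = Set.range (itin a' s.2)}
  have step : ∀ (n : ℕ) (s : S), ∃ s' : S,
      (∃ i : ℕ → ℕ, (∀ x, s.1.1 x = i (s'.1.1 x)) ∧ ∀ y, s.1.2 y = i (s'.1.2 y)) ∧
      (∃ j : ℕ → ℕ, ∀ x, b n x = j (s'.1.1 x)) ∧ ∃ j : ℕ → ℕ, ∀ y, b' n y = j (s'.1.2 y) := by
    rintro n ⟨⟨q, q'⟩, h⟩
    obtain ⟨p', hp'⟩ := ext q q' h (b n)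
    have h1 := pairR _ _ _ _ hp'
    obtain ⟨p, hp⟩ := ext' _ _ h1.symm (b' n)
    have h2 := pairR _ _ _ _ hp.symm
    refine ⟨⟨⟨natPair (natPair q (b n)) p, natPair (natPair q' p') (b' n)⟩, h2⟩,
      ⟨fun m => m.unpair.1.unpair.1, ?_, ?_⟩, ⟨fun m => m.unpair.1.unpair.2, ?_⟩,
      ⟨fun m => m.unpair.2, ?_⟩⟩ <;> intro x <;> simp [natPair]
  choose nxt h1 h2 h3 using step
  let s : ℕ → S := fun n => Nat.rec ⟨(q, q'), hq⟩ (fun n s => nxt n s) n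
  obtain ⟨φ, hφ, hφq⟩ := exists_homeomorph_of_matching ha ha' b hb b' hb'
    (fun n => (s n).1.1) (fun n => (s n).1.2) (fun n => (s n).2)
    (fun n => h1 n (s n)) (fun n => h2 n (s n)) (fun n => h3 n (s n))
  exact ⟨φ, hφ, hφq 0⟩

/-! ### Homogeneity of the Cantor space -/

/-- Every nonempty clopen set can be split by a clopen set. -/
def ClopenSplits (C : Type) [TopologicalSpace C] : Prop :=
  ∀ U : Set C, IsClopen U → U.Nonempty → ∃ V : Set C, IsClopen V ∧ (U ∩ V).Nonempty ∧
    (U \ V).Nonempty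

theorem clopenSplits_of_flip {C : Type} [TopologicalSpace C] (v : ℕ → C → C)
    (b : ℕ → C(C, Bool)) (hv : ∀ x, Filter.Tendsto (fun n => v n x) Filter.atTop (𝓝 x))
    (hb : ∀ n x, b n (v n x) ≠ b n x) : ClopenSplits C := by
  rintro U hU ⟨x, hx⟩
  obtain ⟨n, hn⟩ := ((hv x).eventually (hU.isOpen.mem_nhds hx)).exists
  refine ⟨b n ⁻¹' {b n x}, (isClopen_discrete _).preimage (b n).continuous, ⟨x, hx, rfl⟩,
    ⟨v n x, hn, hb n x⟩⟩

theorem tendsto_update_not (x : Cantor) :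
    Filter.Tendsto (fun n => Function.update x n (!x n)) Filter.atTop (𝓝 x) := by
  refine tendsto_pi_nhds.2 fun i => ?_
  refine Filter.Tendsto.congr' ?_ tendsto_const_nhds
  filter_upwards [Filter.eventually_gt_atTop i] with n hn
  rw [Function.update_of_ne hn.ne]

theorem clopenSplits_prod_cantor (K : Type) [TopologicalSpace K] : ClopenSplits (K × Cantor) :=
  clopenSplits_of_flip (fun n z => (z.1, Function.update z.2 n (!z.2 n)))
    (fun n => ⟨fun z => z.2 n, by fun_prop⟩)
    (fun z => tendsto_const_nhds.prodMk_nhds (tendsto_update_not z.2)) (by simp)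

theorem clopenSplits_cantor : ClopenSplits Cantor :=
  clopenSplits_of_flip (fun n z => Function.update z n (!z n))
    (fun n => ⟨fun z => z n, by fun_prop⟩) tendsto_update_not (by simp)

/-- The `ℕ`-valued coordinate functions on the Cantor space. -/
def cantorBit (n : ℕ) : C(Cantor, ℕ) :=
  ⟨fun x => (x n).toNat,
    (continuous_of_discreteTopology (f := Bool.toNat)).comp (continuous_apply n)⟩

theorem cantorBit_separates (x y : Cantor) (h : ∀ n, cantorBit n x = cantorBit n y) : x = y :=
  funext fun n => by
    have := h n
    simp only [cantorBit, ContinuousMap.coe_mk] at this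
    revert this
    cases x n <;> cases y n <;> simp

theorem countablySeparated_cantor : CountablySeparated Cantor :=
  ⟨cantorBit, cantorBit_separates⟩

theorem CountablySeparated.prod {C D : Type} [TopologicalSpace C] [TopologicalSpace D]
    (hC : CountablySeparated C) (hD : CountablySeparated D) : CountablySeparated (C × D) := by
  obtain ⟨b, hb⟩ := hC
  obtain ⟨d, hd⟩ := hD
  refine ⟨fun n => natPair ((b n).comp ContinuousMap.fst) ((d n).comp ContinuousMap.snd),
    fun x y h => Prod.ext (hb _ _ fun n => ?_) (hd _ _ fun n => ?_)⟩
  · have := h n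
    simp only [natPair, ContinuousMap.coe_mk, Nat.pair_eq_pair] at this
    exact this.1
  · have := h n
    simp only [natPair, ContinuousMap.coe_mk, Nat.pair_eq_pair] at this
    exact this.2

theorem CountablySeparated.subtype {C : Type} [TopologicalSpace C] (hC : CountablySeparated C)
    (S : Set C) : CountablySeparated S := by
  obtain ⟨b, hb⟩ := hC
  exact ⟨fun n => (b n).comp ⟨Subtype.val, continuous_subtype_val⟩,
    fun x y h => Subtype.ext (hb _ _ h)⟩

theorem countablySeparated_fullShift (G B : Type) [Countable G] [Nonempty G] [Countable B]
    [TopologicalSpace B] [DiscreteTopology B] : CountablySeparated (G → B) := by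
  obtain ⟨e, he⟩ := exists_surjective_nat G
  obtain ⟨i, hi⟩ := exists_injective_nat B
  refine ⟨fun n => ⟨fun x => i (x (e n)),
    continuous_of_discreteTopology.comp (continuous_apply (e n))⟩, fun x y h => funext fun g => ?_⟩
  obtain ⟨n, rfl⟩ := he g
  exact hi (h n)

theorem ClopenSplits.exists_image_eq {C : Type} [TopologicalSpace C] (hC : ClopenSplits C)
    (S : Finset ℕ) (hS : S.Nonempty) : ∀ U : Set C, IsClopen U → U.Nonempty →
      ∃ h : C(C, ℕ), h '' U = S := by
  classical
  induction hS using Finset.Nonempty.cons_induction with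
  | singleton a =>
    intro U _ hne
    exact ⟨ContinuousMap.const C a, hne.image_const a |>.trans (by simp)⟩
  | cons a s ha hs ih =>
    intro U hU hne
    obtain ⟨V, hV, h1, h2⟩ := hC U hU hne
    obtain ⟨h, hh⟩ := ih (U ∩ V) (hU.inter hV) h1
    refine ⟨⟨V.piecewise h (fun _ => a), Continuous.piecewise (by simp [hV.frontier_eq])
      h.continuous continuous_const⟩, ?_⟩
    rw [Finset.coe_cons, ← hh]
    ext m
    constructor
    · rintro ⟨x, hx, rfl⟩
      by_cases hxV : x ∈ V
      · right
        exact ⟨x, ⟨hx, hxV⟩, by simp [hxV]⟩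
      · left
        simp [hxV]
    · rintro (rfl | ⟨x, ⟨hx, hxV⟩, rfl⟩)
      · obtain ⟨x, hx, hxV⟩ := h2
        exact ⟨x, hx, by simp [hxV]⟩
      · exact ⟨x, hx, by simp [hxV]⟩

theorem ClopenSplits.exists_extension {C C' : Type} [TopologicalSpace C] [CompactSpace C]
    [TopologicalSpace C'] (hC' : ClopenSplits C') (q : C(C, ℕ)) (q' : C(C', ℕ))
    (h : Set.range q = Set.range q') (p : C(C, ℕ)) :
    ∃ p' : C(C', ℕ), Set.range (q.prodMk p) = Set.range (q'.prodMk p') := by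
  have hk : ∀ k : ℕ, ∃ f : C(C', ℕ), k ∈ Set.range q → f '' (q' ⁻¹' {k}) = p '' (q ⁻¹' {k}) := by
    intro k
    by_cases hk : k ∈ Set.range q
    · have hfin : (p '' (q ⁻¹' {k})).Finite :=
        (isCompact_range p.continuous).finite_of_discrete.subset (Set.image_subset_range _ _)
      obtain ⟨x, hx⟩ := hk
      obtain ⟨y, hy⟩ : k ∈ Set.range q' := h ▸ ⟨x, hx⟩
      obtain ⟨f, hf⟩ := hC'.exists_image_eq hfin.toFinset
        (by simpa using ⟨x, hx⟩) (q' ⁻¹' {k})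
        ((isClopen_discrete _).preimage q'.continuous) ⟨y, hy⟩
      exact ⟨f, fun _ => by simpa using hf⟩
    · exact ⟨ContinuousMap.const _ 0, fun h => absurd h hk⟩
  choose f hf using hk
  have hcont : Continuous fun z : ℕ × C' => f z.1 z.2 :=
    continuous_prod_of_discrete_left.2 fun k => (f k).continuous
  refine ⟨⟨fun y => f (q' y) y, hcont.comp (q'.continuous.prodMk continuous_id)⟩, ?_⟩
  ext ⟨k, m⟩
  constructor
  · rintro ⟨x, hx⟩
    simp only [ContinuousMap.prod_eval, Prod.mk.injEq] at hx
    have : m ∈ f k '' (q' ⁻¹' {k}) := by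
      rw [hf k ⟨x, hx.1⟩]
      exact ⟨x, hx⟩
    obtain ⟨y, hy, hm⟩ := this
    refine ⟨y, ?_⟩
    rw [Set.mem_preimage, Set.mem_singleton_iff] at hy
    simp [hy, hm]
  · rintro ⟨y, hy⟩
    simp only [ContinuousMap.prod_eval, ContinuousMap.coe_mk, Prod.mk.injEq] at hy
    have : m ∈ p '' (q ⁻¹' {k}) := by
      rw [← hf k (h ▸ ⟨y, hy.1⟩)]
      exact ⟨y, hy.1, by rw [← hy.2, hy.1]⟩
    obtain ⟨x, hx, hm⟩ := this
    refine ⟨x, ?_⟩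
    rw [Set.mem_preimage, Set.mem_singleton_iff] at hx
    simp [hx, hm]

theorem range_itin_id {C K : Type} [TopologicalSpace C] [TopologicalSpace K] (p : C(C, K)) :
    Set.range (itin (fun _ : Unit => ContinuousMap.id C) p) =
      (fun k (_ : Unit) => k) '' Set.range p := by
  rw [← Set.range_comp]
  rfl

/-- Two continuous maps with the same range, from spaces homeomorphic to the Cantor space to
a countable discrete space, differ by a homeomorphism. -/
theorem exists_homeomorph_comp_eq {C C' K : Type} [TopologicalSpace C]
    [TopologicalSpace C'] [CompactSpace C] [CompactSpace C'] [T2Space C']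
    (hC : CountablySeparated C) (hC' : CountablySeparated C')
    (sC : ClopenSplits C) (sC' : ClopenSplits C') [Countable K] [TopologicalSpace K]
    [DiscreteTopology K] (q : C(C, K)) (q' : C(C', K)) (h : Set.range q = Set.range q') :
    ∃ φ : C ≃ₜ C', ∀ x, q' (φ x) = q x := by
  obtain ⟨i, hi⟩ := exists_injective_nat K
  let ι : C(K, ℕ) := ⟨i, continuous_of_discreteTopology⟩
  have hconst : Function.Injective (fun k (_ : Unit) => k : ℕ → Unit → ℕ) :=
    fun x y h => congrFun h ()
  have hext : ∀ {D D' : Type} [TopologicalSpace D] [CompactSpace D] [TopologicalSpace D'],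
      ClopenSplits D' → ∀ (r : C(D, ℕ)) (r' : C(D', ℕ)),
      Set.range (itin (fun _ : Unit => ContinuousMap.id D) r) =
        Set.range (itin (fun _ : Unit => ContinuousMap.id D') r') →
      ∀ p : C(D, ℕ), ∃ p' : C(D', ℕ),
        Set.range (itin (fun _ : Unit => ContinuousMap.id D) (r.prodMk p)) =
          Set.range (itin (fun _ : Unit => ContinuousMap.id D') (r'.prodMk p')) := by
    intro D D' _ _ _ hD r r' h p
    simp only [range_itin_id] at h ⊢
    obtain ⟨p', hp'⟩ := hD.exists_extension r r' (hconst.image_injective h) p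
    exact ⟨p', by rw [hp']⟩
  have hιq : Set.range (itin (fun _ : Unit => ContinuousMap.id C) (ι.comp q)) =
      Set.range (itin (fun _ : Unit => ContinuousMap.id C') (ι.comp q')) := by
    rw [range_itin_id, range_itin_id, ContinuousMap.coe_comp, ContinuousMap.coe_comp,
      Set.range_comp, Set.range_comp, h]
  obtain ⟨φ, -, hφ⟩ := exists_homeomorph_of_extension (G := Unit) ⟨rfl, fun _ _ => rfl⟩
    ⟨rfl, fun _ _ => rfl⟩ hC hC' (hext sC') (hext sC) (ι.comp q) (ι.comp q') hιq
  exact ⟨φ, fun x => hi (hφ x)⟩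

/-- Every action on a nonempty compact zero-dimensional metrizable space is a factor of an action
on the Cantor space. -/
theorem exists_cantor_cover {G K : Type} [Group G] [TopologicalSpace K] [CompactSpace K]
    [T2Space K] [Nonempty K] (hK : CountablySeparated K) {a : G → C(K, K)} (ha : IsAct a) :
    ∃ (α : ActSpace G) (t : C(Cantor, K)), Function.Surjective t ∧
      ∀ g x, t (α.1 g x) = a g (t x) := by
  obtain ⟨φ, -⟩ := exists_homeomorph_comp_eq (C := Cantor) (C' := K × Cantor) (K := Unit)
    countablySeparated_cantor (hK.prod countablySeparated_cantor) clopenSplits_cantor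
    (clopenSplits_prod_cantor K) (ContinuousMap.const _ ()) (ContinuousMap.const _ ())
    (Set.range_const.trans Set.range_const.symm)
  have h1 : ∀ k, a 1 k = k := fun k => by rw [ha.1]; rfl
  have h2 : ∀ g h k, a (g * h) k = a g (a h k) := fun g h k => by rw [ha.2]; rfl
  refine ⟨⟨fun g => ⟨fun x => φ.symm (a g (φ x).1, (φ x).2), by fun_prop⟩, ?_, fun g h => ?_⟩,
    ⟨fun x => (φ x).1, by fun_prop⟩, fun k => ⟨φ.symm (k, fun _ => false), by simp⟩, ?_⟩
  · ext x : 1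
    simp [h1]
  · ext x : 1
    simp [h2]
  · intro g x
    simp

/-! ### The topology of the space of actions -/

theorem discreteTopology_continuousMap (X Y : Type) [TopologicalSpace X] [CompactSpace X]
    [TopologicalSpace Y] [DiscreteTopology Y] : DiscreteTopology C(X, Y) := by
  refine discreteTopology_iff_nhds.2 fun f => ?_
  refine le_antisymm ?_ (pure_le_nhds f)
  rw [Filter.le_pure_iff]
  have hfin : (Set.range f).Finite := (isCompact_range f.continuous).finite_of_discrete
  have h : ∀ y ∈ Set.range f, ∀ᶠ g : C(X, Y) in 𝓝 f, Set.MapsTo g (f ⁻¹' {y}) {y} := fun y _ =>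
    ContinuousMap.eventually_mapsTo
      ((isClosed_discrete _).preimage f.continuous).isCompact (isOpen_discrete _) fun _ hx => hx
  filter_upwards [(Filter.eventually_all_finite hfin).2 h] with g hg
  ext x
  exact hg (f x) ⟨x, rfl⟩ rfl

theorem countable_continuousMap_cantor (Y : Type) [TopologicalSpace Y] [DiscreteTopology Y]
    [Countable Y] : Countable C(Cantor, Y) := by
  have := discreteTopology_continuousMap Cantor Y
  exact TopologicalSpace.separableSpace_iff_countable.1 inferInstance

theorem isClosed_isAction (G : Type) [Group G] :
    IsClosed {α : G → C(Cantor, Cantor) | IsAction G α} := by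
  refine IsClosed.inter (isClosed_eq (continuous_apply 1) continuous_const) ?_
  change IsClosed {α : G → C(Cantor, Cantor) | ∀ g h, α (g * h) = (α g).comp (α h)}
  simp only [Set.ofPred_forall]
  exact isClosed_iInter fun g => isClosed_iInter fun h => isClosed_eq (continuous_apply _)
    ((continuous_apply g).compCM (continuous_apply h))

theorem polishSpace_actSpace (G : Type) [Group G] [Countable G] : PolishSpace (ActSpace G) := by
  have : (uniformity Bool).IsCountablyGenerated :=
    Filter.isCountablyGenerated_principal SetRel.id
  have : (uniformity Cantor).IsCountablyGenerated := inferInstance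
  have : (uniformity C(Cantor, Cantor)).IsCountablyGenerated := inferInstance
  have : TopologicalSpace.IsCompletelyMetrizableSpace C(Cantor, Cantor) :=
    TopologicalSpace.IsCompletelyMetrizableSpace.of_completeSpace_metrizable
  have : PolishSpace C(Cantor, Cantor) := {}
  exact (isClosed_isAction G).polishSpace

theorem continuous_eval_actSpace {G K : Type} [Group G] [TopologicalSpace K] (p : C(Cantor, K)) :
    Continuous fun z : ActSpace G × Cantor => itin z.1.1 p z.2 := by
  refine continuous_pi fun g => p.continuous.comp ?_
  exact ((continuous_apply g⁻¹).comp (continuous_subtype_val.comp continuous_fst)).eval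
    continuous_snd

theorem eventually_comp_eq {G K : Type} [Group G] [TopologicalSpace K] [DiscreteTopology K]
    (α : ActSpace G) (r : C(Cantor, K)) (F : Finset G) :
    ∀ᶠ β : ActSpace G in 𝓝 α, ∀ g ∈ F, ∀ x, itin β.1 r x g = itin α.1 r x g := by
  have := discreteTopology_continuousMap Cantor K
  refine (Filter.eventually_all_finset F).2 fun g _ => ?_
  have hc : Continuous fun β : ActSpace G => r.comp (β.1 g⁻¹) :=
    (ContinuousMap.continuous_postcomp r).comp
      ((continuous_apply g⁻¹).comp continuous_subtype_val)
  have := (hc.tendsto α).eventually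
    (show ∀ᶠ f in 𝓝 (r.comp (α.1 g⁻¹)), f = r.comp (α.1 g⁻¹) from
      (isOpen_discrete _).mem_nhds (Set.mem_singleton _))
  filter_upwards [this] with β hβ x
  exact congrArg (fun f : C(Cantor, K) => f x) hβ

theorem exists_agree_subset {G : Type} [Group G] [Countable G] (α : ActSpace G)
    {U : Set (ActSpace G)} (hU : U ∈ 𝓝 α) : ∃ (k : ℕ) (F : Finset G), ∀ β : ActSpace G,
      (∀ g ∈ F, ∀ x, ∀ i < k, β.1 g⁻¹ x i = α.1 g⁻¹ x i) → β ∈ U := by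
  by_contra! hcon
  obtain ⟨e, he⟩ := exists_injective_nat G
  have hfin : ∀ k : ℕ, {g | e g < k}.Finite := fun k =>
    Set.Finite.preimage he.injOn (Set.finite_Iio k)
  choose β hβ hβU using fun k => hcon k (hfin k).toFinset
  have hlim : Filter.Tendsto β Filter.atTop (𝓝 α) := by
    refine tendsto_subtype_rng.2 (tendsto_pi_nhds.2 fun g => ?_)
    rw [ContinuousMap.tendsto_iff_tendstoUniformly, tendstoUniformly_iff_tendsto,
      Pi.uniformity, Filter.tendsto_iInf]
    intro i
    rw [Filter.tendsto_comap_iff]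
    refine Filter.Tendsto.mono_right ?_ refl_le_uniformity
    rw [Filter.tendsto_principal]
    have : ∀ᶠ n in (Filter.atTop : Filter ℕ), ∀ x, (β n).1 g x i = α.1 g x i := by
      filter_upwards [Filter.eventually_gt_atTop i, Filter.eventually_gt_atTop (e g⁻¹)] with n h1 h2 x
      simpa using hβ n g⁻¹ (by simpa using h2) x i h1
    filter_upwards [this.prod_inl (⊤ : Filter Cantor)] with z hz
    exact (hz z.2).symm
  obtain ⟨k, hk⟩ := (hlim.eventually hU).exists
  exact hβU k hk

/-! ### Conjugation, factors and amalgamation -/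

/-- The conjugate of an action on the Cantor space by a homeomorphism. -/
def conjAct {G : Type} [Group G] (ψ : Cantor ≃ₜ Cantor) (β : ActSpace G) : ActSpace G :=
  ⟨fun g => ⟨fun x => ψ (β.1 g (ψ.symm x)), by fun_prop⟩, by
    ext x : 1
    simp [β.2.1], fun g h => by
    ext x : 1
    simp [β.2.2]⟩

theorem range_itin_conjAct {G K : Type} [Group G] [TopologicalSpace K] (ψ : Cantor ≃ₜ Cantor)
    (β : ActSpace G) (p : C(Cantor, K)) :
    Set.range (itin (conjAct ψ β).1 p) = Set.range (itin β.1 (p.comp (ψ : C(Cantor, Cantor)))) :=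
  ψ.symm.surjective.range_comp (itin β.1 (p.comp (ψ : C(Cantor, Cantor))))

theorem range_itin_of_factor {G K : Type} [Group G] [TopologicalSpace K] {α γ : ActSpace G}
    {t : C(Cantor, Cantor)} (ht : Function.Surjective t)
    (hequiv : ∀ g x, t (α.1 g x) = γ.1 g (t x)) (p : C(Cantor, K)) :
    Set.range (itin α.1 (p.comp t)) = Set.range (itin γ.1 p) := by
  rw [← ht.range_comp (itin γ.1 p)]
  congr 1
  funext x g
  simp [itin, hequiv]

/-- The map `p` together with the first `k` coordinates of the Cantor space. -/
def refineMap {A : Type} [TopologicalSpace A] (p : C(Cantor, A)) (k : ℕ) :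
    C(Cantor, A × (Fin k → Bool)) :=
  ⟨fun x => (p x, fun i => x i), by fun_prop⟩

theorem patterns_range {G A C : Type} (F : Finset G) (f : C → G → A) :
    patterns F (Set.range f) = Set.range fun x (g : F) => f x g :=
  (Set.range_comp _ _).symm

theorem patterns_range_congr {G A C : Type} (F : Finset G) (f f' : C → G → A)
    (h : ∀ g ∈ F, ∀ x, f x g = f' x g) :
    patterns F (Set.range f) = patterns F (Set.range f') := by
  rw [patterns_range, patterns_range]
  congr 1
  funext x g
  exact h g g.2 x

/-- Membership in a neighbourhood of an action, up to conjugacy, is a matter of patterns. -/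
theorem exists_conjAct_mem {G : Type} [Group G] [Countable G] (α : ActSpace G)
    {U : Set (ActSpace G)} (hU : U ∈ 𝓝 α) {A : Type} [TopologicalSpace A] [DiscreteTopology A]
    [Countable A] (p : C(Cantor, A)) :
    ∃ (k : ℕ) (F : Finset G), ∀ (β : ActSpace G) (u : C(Cantor, A × (Fin k → Bool))),
      patterns F (Set.range (itin β.1 u)) = patterns F (Set.range (itin α.1 (refineMap p k))) →
      ∃ ψ : Cantor ≃ₜ Cantor, (∀ x, refineMap p k (ψ x) = u x) ∧ conjAct ψ β ∈ U := by
  classical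
  obtain ⟨k, F, hF⟩ := exists_agree_subset α hU
  refine ⟨k, insert 1 F, fun β u h => ?_⟩
  rw [patterns_range, patterns_range] at h
  let P : ActSpace G → C(Cantor, A × (Fin k → Bool)) →
      C(Cantor, (insert 1 F : Finset G) → A × (Fin k → Bool)) := fun γ r =>
    ⟨fun x g => itin γ.1 r x g, continuous_pi fun g =>
      (continuous_apply (g : G)).comp (continuous_itin γ.1 r)⟩
  obtain ⟨ψ, hψ⟩ := exists_homeomorph_comp_eq countablySeparated_cantor countablySeparated_cantor
    clopenSplits_cantor clopenSplits_cantor (P β u) (P α (refineMap p k)) h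
  have key : ∀ g ∈ insert 1 F, ∀ x, itin α.1 (refineMap p k) (ψ x) g = itin β.1 u x g :=
    fun g hg x => congrFun (hψ x) ⟨g, hg⟩
  have hone : ∀ x, refineMap p k (ψ x) = u x := fun x => by
    have := key 1 (Finset.mem_insert_self _ _) x
    rwa [itin_one α.2, itin_one β.2] at this
  refine ⟨ψ, hone, hF _ fun g hg x i hi => ?_⟩
  have := key g (Finset.mem_insert_of_mem hg) (ψ.symm x)
  simp only [itin, ← hone, Homeomorph.apply_symm_apply] at this
  exact (congrFun (congrArg Prod.snd this) ⟨i, hi⟩).symm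

/-- The subshift of itineraries with respect to `p` is locally constant at `α`. -/
def LocConstAt {G A : Type} [Group G] [TopologicalSpace A] (p : C(Cantor, A))
    (α : ActSpace G) : Prop :=
  ∀ᶠ β : ActSpace G in 𝓝 α, Set.range (itin β.1 p) = Set.range (itin α.1 p)

theorem locConstAt_of_eventually {G A : Type} [Group G] [TopologicalSpace A] {p : C(Cantor, A)}
    {α : ActSpace G} {S : Set (G → A)}
    (h : ∀ᶠ β : ActSpace G in 𝓝 α, Set.range (itin β.1 p) = S) : LocConstAt p α := by
  filter_upwards [h] with β hβ
  rw [hβ, h.self_of_nhds]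

theorem isOpen_locConstAt {G A : Type} [Group G] [TopologicalSpace A] (p : C(Cantor, A)) :
    IsOpen {α : ActSpace G | LocConstAt p α} := by
  refine isOpen_iff_mem_nhds.2 fun α hα => ?_
  filter_upwards [eventually_eventually_nhds.2 hα] with β hβ
  exact locConstAt_of_eventually hβ

theorem LocConstAt.comp {G A B : Type} [Group G] [TopologicalSpace A] [TopologicalSpace B]
    {p : C(Cantor, A)} {α : ActSpace G} (h : LocConstAt p α) (i : C(A, B)) :
    LocConstAt (i.comp p) α := by
  filter_upwards [h] with β hβ
  rw [range_itin_comp β.1 p (i.comp p) i fun _ => rfl,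
    range_itin_comp α.1 p (i.comp p) i fun _ => rfl, hβ]

theorem eventually_range_itin_factor {G A : Type} [Group G] [Countable G] [TopologicalSpace A]
    [DiscreteTopology A] [Countable A] {α γ : ActSpace G} {t : C(Cantor, Cantor)}
    (ht : Function.Surjective t) (hequiv : ∀ g x, t (α.1 g x) = γ.1 g (t x))
    {p : C(Cantor, A)} (hp : LocConstAt p γ) :
    ∀ᶠ β : ActSpace G in 𝓝 α, Set.range (itin β.1 (p.comp t)) = Set.range (itin γ.1 p) := by
  obtain ⟨k, F, hF⟩ := exists_conjAct_mem γ hp p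
  filter_upwards [eventually_comp_eq α ((refineMap p k).comp t) F] with β hβ
  obtain ⟨ψ, hψ, hψU⟩ := hF β ((refineMap p k).comp t) (by
    rw [patterns_range_congr F _ _ hβ, range_itin_of_factor ht hequiv])
  have h1 : p.comp t = p.comp (ψ : C(Cantor, Cantor)) := by
    ext x : 1
    exact (congrArg Prod.fst (hψ x)).symm
  rw [h1, ← range_itin_conjAct]
  exact hψU

theorem exists_amalgam {G : Type} [Group G] [Countable G] (α γ : ActSpace G)
    {U : Set (ActSpace G)} (hU : U ∈ 𝓝 α) {A B : Type} [TopologicalSpace A] [DiscreteTopology A]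
    [Countable A] [TopologicalSpace B] (q : C(Cantor, A)) (p : C(Cantor, B)) (i : C(B, A))
    (h : Set.range (itin α.1 q) = Set.range (itin γ.1 (i.comp p))) :
    ∃ δ ∈ U, ∃ t : C(Cantor, Cantor), Function.Surjective t ∧
      (∀ g x, t (δ.1 g x) = γ.1 g (t x)) ∧ ∀ x, i (p (t x)) = q x := by
  let K : Set (Cantor × Cantor) := {z | itin α.1 q z.1 = itin γ.1 (i.comp p) z.2}
  have hK : IsClosed K := by
    have : T2Space A := inferInstance
    exact isClosed_eq ((continuous_itin _ _).comp continuous_fst)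
      ((continuous_itin _ _).comp continuous_snd)
  have hKcompact : CompactSpace K := isCompact_iff_compactSpace.1 hK.isCompact
  have hleft : ∀ x, ∃ y, (x, y) ∈ K := fun x => by
    have : itin α.1 q x ∈ Set.range (itin γ.1 (i.comp p)) := h ▸ Set.mem_range_self x
    obtain ⟨y, hy⟩ := this
    exact ⟨y, hy.symm⟩
  have hright : ∀ y, ∃ x, (x, y) ∈ K := fun y => by
    have : itin γ.1 (i.comp p) y ∈ Set.range (itin α.1 q) := h ▸ Set.mem_range_self y
    exact this
  have hKne : Nonempty K := let ⟨y, hy⟩ := hleft fun _ => false; ⟨⟨_, hy⟩⟩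
  have hinv : ∀ g, ∀ z ∈ K, (α.1 g z.1, γ.1 g z.2) ∈ K := fun g z hz => by
    change itin α.1 q (α.1 g z.1) = itin γ.1 (i.comp p) (γ.1 g z.2)
    rw [← shift_itin α.2, ← shift_itin γ.2, show itin α.1 q z.1 = _ from hz]
  let a : G → C(K, K) := fun g =>
    ⟨fun z => ⟨(α.1 g z.1.1, γ.1 g z.1.2), hinv g z z.2⟩, by fun_prop⟩
  have ha : IsAct a := by
    refine ⟨?_, fun g h => ?_⟩
    · ext z : 2
      simp [a, α.2.1, γ.2.1]
    · ext z : 2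
      simp [a, α.2.2, γ.2.2]
  obtain ⟨δ, s, hs, hsa⟩ := exists_cantor_cover
    ((countablySeparated_cantor.prod countablySeparated_cantor).subtype K) ha
  let s₁ : C(Cantor, Cantor) := ⟨fun x => (s x).1.1, by fun_prop⟩
  let s₂ : C(Cantor, Cantor) := ⟨fun x => (s x).1.2, by fun_prop⟩
  have hs₁ : Function.Surjective s₁ := fun x => by
    obtain ⟨y, hy⟩ := hleft x
    obtain ⟨w, hw⟩ := hs ⟨_, hy⟩
    exact ⟨w, by simp [s₁, hw]⟩
  have hs₂ : Function.Surjective s₂ := fun y => by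
    obtain ⟨x, hx⟩ := hright y
    obtain ⟨w, hw⟩ := hs ⟨_, hx⟩
    exact ⟨w, by simp [s₂, hw]⟩
  have hs₁a : ∀ g x, s₁ (δ.1 g x) = α.1 g (s₁ x) := fun g x => by
    simp [s₁, hsa, a]
  have hs₂a : ∀ g x, s₂ (δ.1 g x) = γ.1 g (s₂ x) := fun g x => by
    simp [s₂, hsa, a]
  have hcompat : ∀ x, i (p (s₂ x)) = q (s₁ x) := fun x => by
    have := congrFun (show itin α.1 q (s₁ x) = itin γ.1 (i.comp p) (s₂ x) from (s x).2) 1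
    rw [itin_one α.2, itin_one γ.2] at this
    exact this.symm
  obtain ⟨k, F, hF⟩ := exists_conjAct_mem α hU q
  obtain ⟨ψ, hψ, hψU⟩ := hF δ ((refineMap q k).comp s₁) (by rw [range_itin_of_factor hs₁ hs₁a])
  refine ⟨conjAct ψ δ, hψU, s₂.comp (ψ.symm : C(Cantor, Cantor)), ?_, fun g x => ?_, fun x => ?_⟩
  · exact hs₂.comp ψ.symm.surjective
  · simp [conjAct, hs₂a]
  · have := congrArg Prod.fst (hψ (ψ.symm x))
    simp only [Homeomorph.apply_symm_apply] at this
    exact (hcompat _).trans this.symm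

/-! ### Subshifts and actions on the Cantor space -/

theorem isSubshift_range_itin {G A : Type} [Group G] [TopologicalSpace A] [DiscreteTopology A]
    (α : ActSpace G) (p : C(Cantor, A)) : IsSubshift G A (Set.range (itin α.1 p)) := by
  refine ⟨?_, ?_⟩
  · have h : IsClosed (Set.range (itin α.1 p)) :=
      (isCompact_range (continuous_itin α.1 p)).isClosed
    obtain rfl := DiscreteTopology.eq_bot (α := A)
    exact h
  · rintro g _ ⟨x, rfl⟩
    exact ⟨α.1 g x, (shift_itin α.2 p g x).symm⟩

theorem exists_range_itin_eq {G B : Type} [Group G] [Countable G] [Finite B]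
    [TopologicalSpace B] [DiscreteTopology B] {Y : Set (G → B)} (hY : IsSubshift G B Y)
    (hne : Y.Nonempty) : ∃ (α : ActSpace G) (u : C(Cantor, B)), Set.range (itin α.1 u) = Y := by
  have hclosed : IsClosed Y := by
    obtain rfl := DiscreteTopology.eq_bot (α := B)
    exact hY.1
  have : CompactSpace Y := isCompact_iff_compactSpace.1 hclosed.isCompact
  have : Nonempty Y := hne.to_subtype
  have hcont : ∀ g : G, Continuous fun y : Y => shift g y.1 := fun g =>
    continuous_pi fun h => (continuous_apply (g⁻¹ * h)).comp continuous_subtype_val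
  let a : G → C(Y, Y) := fun g =>
    ⟨fun y => ⟨shift g y.1, hY.2 g y y.2⟩, (hcont g).subtype_mk _⟩
  have ha : IsAct a := by
    refine ⟨?_, fun g h => ?_⟩
    · ext y g
      simp [a, shift]
    · ext y k
      simp [a, shift, mul_assoc]
  obtain ⟨α, t, ht, hta⟩ := exists_cantor_cover ((countablySeparated_fullShift G B).subtype Y) ha
  let u : C(Cantor, B) := ⟨fun x => (t x).1 1,
    (continuous_apply 1).comp (continuous_subtype_val.comp t.continuous)⟩
  refine ⟨α, u, ?_⟩
  have : itin α.1 u = Subtype.val ∘ t := by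
    funext x g
    simp [itin, u, hta, a, shift]
  rw [this, Set.range_comp, ht.range_eq, Set.image_univ, Subtype.range_val]

theorem range_itin_slidingBlock {G A B : Type} [Group G] [TopologicalSpace A] [TopologicalSpace B]
    {a : G → C(Cantor, Cantor)} (ha : IsAct a) {D : Finset G} {f : (D → B) → A}
    {r : C(Cantor, B)} {p : C(Cantor, A)} (h : ∀ x, p x = f fun d => itin a r x d) :
    Set.range (itin a p) = slidingBlock D f '' Set.range (itin a r) := by
  rw [← Set.range_comp]
  congr 1
  funext x g
  simp [itin, h, slidingBlock, ha.2]

theorem dense_locConstAt_of_hasSTRP {G : Type} [Group G] [Countable G] (h : HasSTRP G) {A : Type}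
    [TopologicalSpace A] [DiscreteTopology A] [Countable A] (p : C(Cantor, A)) :
    Dense {α : ActSpace G | LocConstAt p α} := by
  have := polishSpace_actSpace G
  have := countable_continuousMap_cantor A
  obtain ⟨α₀, h₀⟩ := h
  obtain ⟨t, htsub, htG, htd⟩ := mem_residual.1 h₀
  let E : C(Cantor, A) → Set (ActSpace G) := fun p' =>
    {β | Set.range (itin β.1 p) = Set.range (itin α₀.1 p')}
  have hE : ∀ p', IsClosed (E p') := fun p' => by
    have hS : IsClosed (Set.range (itin α₀.1 p')) :=
      (isCompact_range (continuous_itin α₀.1 p')).isClosed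
    have h1 : E p' = (⋂ x, {β : ActSpace G | itin β.1 p x ∈ Set.range (itin α₀.1 p')}) ∩
        ⋂ y, Prod.fst '' {z : ActSpace G × Cantor | itin z.1.1 p z.2 = itin α₀.1 p' y} := by
      ext β
      simp only [E, Set.mem_inter_iff, Set.mem_iInter, Set.mem_image, Prod.exists,
        Set.mem_ofPred_eq, exists_and_right, exists_eq_right]
      constructor
      · intro h
        exact ⟨fun x => h ▸ Set.mem_range_self x, fun y => h.ge (Set.mem_range_self y)⟩
      · rintro ⟨h1, h2⟩
        exact Set.Subset.antisymm (Set.range_subset_iff.2 h1) (Set.range_subset_iff.2 h2)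
    rw [h1]
    refine (isClosed_iInter fun x => ?_).inter (isClosed_iInter fun y => ?_)
    · exact hS.preimage ((continuous_eval_actSpace p).comp (Continuous.prodMk_left x))
    · exact isClosedMap_fst_of_compactSpace _
        (isClosed_eq (continuous_eval_actSpace p) continuous_const)
  have hcov : t ⊆ ⋃ p', E p' := fun β hβ => by
    obtain ⟨φ, hφ⟩ := htsub hβ
    have : β = conjAct φ α₀ := Subtype.ext (funext fun g => DFunLike.coe_injective (hφ g))
    exact Set.mem_iUnion.2 ⟨p.comp (φ : C(Cantor, Cantor)), this ▸ range_itin_conjAct φ α₀ p⟩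
  refine (htG.dense_iUnion_interior_of_closed htd hE hcov).mono (Set.iUnion_subset fun p' β hβ => ?_)
  exact locConstAt_of_eventually (mem_interior_iff_mem_nhds.1 hβ)

theorem projIsolated_empty (G A : Type) [Group G] [Nonempty A] : ProjIsolated G A ∅ := by
  refine ⟨Bool, inferInstance, inferInstance, ∅, ∅, ∅, fun _ => Classical.arbitrary A,
    ⟨isClosed_empty, by simp⟩, Set.image_empty _, fun Z _ hZ => ?_⟩
  simp only [patterns, Set.image_empty, Set.image_eq_empty] at hZ ⊢
  exact hZ

theorem projIsolated_range_itin {G A : Type} [Group G] [Countable G] [Fintype A] [Nontrivial A]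
    [TopologicalSpace A] [DiscreteTopology A] {β : ActSpace G} {p : C(Cantor, A)}
    (h : LocConstAt p β) : ProjIsolated G A (Set.range (itin β.1 p)) := by
  obtain ⟨k, F, hF⟩ := exists_conjAct_mem β h p
  let f : (({1} : Finset G) → A × (Fin k → Bool)) → A := fun v => (v ⟨1, by simp⟩).1
  refine ⟨A × (Fin k → Bool), inferInstance, inferInstance,
    Set.range (itin β.1 (refineMap p k)), F, {1}, f, isSubshift_range_itin _ _, ?_,
    fun Z hZ hZF => ?_⟩
  · refine (range_itin_slidingBlock β.2 fun x => ?_).symm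
    simp [f, itin_one β.2, refineMap]
  · have hne : Z.Nonempty := by
      rw [← Set.image_nonempty (f := fun (x : G → A × (Fin k → Bool)) (f : F) => x (f : G))]
      change (patterns F Z).Nonempty
      rw [hZF]
      exact (Set.range_nonempty _).image _
    obtain ⟨γ, u, rfl⟩ := exists_range_itin_eq hZ hne
    obtain ⟨ψ, hψ, hψU⟩ := hF γ u hZF
    have h1 : Set.range (itin (conjAct ψ γ).1 p) = Set.range (itin β.1 p) := hψU
    rw [← h1, range_itin_conjAct]
    refine (range_itin_slidingBlock γ.2 fun x => ?_).symm
    simp [f, itin_one γ.2, ← hψ, refineMap]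

theorem exists_projIsolated_of_dense {G A : Type} [Group G] [Countable G] [Fintype A]
    [Nontrivial A] [TopologicalSpace A] [DiscreteTopology A]
    (h : ∀ p : C(Cantor, A), Dense {α : ActSpace G | LocConstAt p α})
    {X : Set (G → A)} (hX : IsSubshift G A X) (F : Finset G) :
    ∃ X' : Set (G → A), IsSubshift G A X' ∧ ProjIsolated G A X' ∧
      patterns F X' = patterns F X := by
  rcases X.eq_empty_or_nonempty with rfl | hne
  · exact ⟨∅, hX, projIsolated_empty G A, rfl⟩
  · obtain ⟨α, p, rfl⟩ := exists_range_itin_eq hX hne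
    obtain ⟨β, hβ, hβF⟩ := (h p).inter_nhds_nonempty (eventually_comp_eq α p F)
    exact ⟨_, isSubshift_range_itin β p, projIsolated_range_itin hβ,
      patterns_range_congr F _ _ hβF⟩

theorem dense_locConstAt_of_projIsolated {G A : Type} [Group G] [Countable G] [Fintype A]
    [Nontrivial A] [TopologicalSpace A] [DiscreteTopology A]
    (h : ∀ (A : Type) (_ : Fintype A) (_ : Nontrivial A) (X : Set (G → A)),
      IsSubshift G A X → ∀ F : Finset G, ∃ X' : Set (G → A), IsSubshift G A X' ∧
        ProjIsolated G A X' ∧ patterns F X' = patterns F X) (p : C(Cantor, A)) :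
    Dense {α : ActSpace G | LocConstAt p α} := by
  classical
  refine dense_iff_inter_open.2 fun U hU ⟨α₀, hα₀⟩ => ?_
  obtain ⟨k, F, hF⟩ := exists_conjAct_mem α₀ (hU.mem_nhds hα₀) p
  obtain ⟨X', hX', ⟨B, _, _, Y, F', D, f, hY, rfl, hiso⟩, hpat⟩ :=
    h (A × (Fin k → Bool)) inferInstance inferInstance _
      (isSubshift_range_itin α₀ (refineMap p k)) F
  have hne : Y.Nonempty := by
    rw [← Set.image_nonempty (f := slidingBlock D f),
      ← Set.image_nonempty (f := fun (x : G → A × (Fin k → Bool)) (f : F) => x (f : G))]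
    change (patterns F _).Nonempty
    rw [hpat]
    exact (Set.range_nonempty _).image _
  let _ : TopologicalSpace B := ⊥
  have : DiscreteTopology B := ⟨rfl⟩
  obtain ⟨α₁, u, rfl⟩ := exists_range_itin_eq hY hne
  let p' : C(Cantor, A × (Fin k → Bool)) := ⟨fun x => f fun d => itin α₁.1 u x d,
    (continuous_of_discreteTopology (f := f)).comp
      (continuous_pi fun d => (continuous_apply (d : G)).comp (continuous_itin α₁.1 u))⟩
  obtain ⟨ψ, hψ, hψU⟩ := hF α₁ p' (by
    rw [range_itin_slidingBlock α₁.2 (fun x => rfl : ∀ x, p' x = f fun d => itin α₁.1 u x d), hpat])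
  let r : C(Cantor, B) := u.comp (ψ.symm : C(Cantor, Cantor))
  have hr : r.comp (ψ : C(Cantor, Cantor)) = u := by
    ext x : 1
    simp [r]
  have hru : ∀ x, itin (conjAct ψ α₁).1 r x = itin α₁.1 u (ψ.symm x) := fun x => by
    funext g
    simp [itin, conjAct, r]
  have hev : ∀ᶠ β : ActSpace G in 𝓝 (conjAct ψ α₁), Set.range (itin β.1 (refineMap p k)) =
      slidingBlock D f '' Set.range (itin α₁.1 u) := by
    filter_upwards [eventually_comp_eq (conjAct ψ α₁) r (D ∪ F')] with β hβ
    rw [range_itin_slidingBlock (r := r) (D := D) (f := f) β.2 fun x => ?_]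
    · refine hiso _ (isSubshift_range_itin β r) ?_
      rw [patterns_range_congr F' _ _ fun g hg => hβ g (Finset.mem_union_right _ hg),
        range_itin_conjAct, hr]
    · have h1 : (fun d : D => itin β.1 r x d) = fun d : D => itin α₁.1 u (ψ.symm x) d :=
        funext fun d => by rw [hβ d (Finset.mem_union_left _ d.2), hru]
      rw [h1]
      exact (congrArg (refineMap p k) (ψ.apply_symm_apply x)).symm.trans (hψ (ψ.symm x))
  exact ⟨conjAct ψ α₁, hψU, (locConstAt_of_eventually hev).comp ⟨Prod.fst, continuous_fst⟩⟩

theorem dense_locConstAt_of_finite {G : Type} [Group G]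
    (h : ∀ (A : Type) [Fintype A] [Nontrivial A] [TopologicalSpace A] [DiscreteTopology A]
      (p : C(Cantor, A)), Dense {α : ActSpace G | LocConstAt p α})
    {K : Type} [TopologicalSpace K] [DiscreteTopology K] (p : C(Cantor, K)) :
    Dense {α : ActSpace G | LocConstAt p α} := by
  have : Finite (Set.range p) := (isCompact_range p.continuous).finite_of_discrete
  have := Fintype.ofFinite (Set.range p)
  have : Nonempty (Set.range p) := (Set.range_nonempty p).to_subtype
  let p' : C(Cantor, Bool × Set.range p) :=
    ⟨fun x => (false, ⟨p x, Set.mem_range_self x⟩), by fun_prop⟩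
  let i : C(Bool × Set.range p, K) := ⟨fun z => z.2.1, by fun_prop⟩
  exact (h _ p').mono fun α (hα : LocConstAt p' α) => hα.comp i

/-! ### A comeager conjugacy class -/

/-- The set of actions that either robustly realise `S` as an extension of the itineraries of `q`,
or robustly have itineraries of `q` different from the projection of `S`. -/
def extensionSet {G : Type} [Group G] (q : C(Cantor, ℕ)) (S : Set (G → ℕ × ℕ)) :
    Set (ActSpace G) :=
  {α | (∃ q' : C(Cantor, ℕ), ∀ᶠ β : ActSpace G in 𝓝 α,
      Set.range (itin β.1 (q.prodMk q')) = S) ∨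
    ∀ᶠ β : ActSpace G in 𝓝 α, Set.range (itin β.1 q) ≠ (fun z => Prod.fst ∘ z) '' S}

theorem isOpen_extensionSet {G : Type} [Group G] (q : C(Cantor, ℕ)) (S : Set (G → ℕ × ℕ)) :
    IsOpen (extensionSet q S) := by
  refine isOpen_iff_mem_nhds.2 fun α hα => ?_
  rcases hα with ⟨q', h⟩ | h
  · filter_upwards [eventually_eventually_nhds.2 h] with β hβ using Or.inl ⟨q', hβ⟩
  · filter_upwards [eventually_eventually_nhds.2 h] with β hβ using Or.inr hβ

theorem dense_extensionSet {G : Type} [Group G] [Countable G]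
    (h : ∀ q : C(Cantor, ℕ), Dense {α : ActSpace G | LocConstAt q α}) (q : C(Cantor, ℕ))
    {γ : ActSpace G} {p : C(Cantor, ℕ × ℕ)} (hp : LocConstAt p γ) :
    Dense (extensionSet q (Set.range (itin γ.1 p))) := by
  refine dense_iff_inter_open.2 fun U hU hne => ?_
  obtain ⟨α, hαU, hα⟩ := (h q).inter_open_nonempty U hU hne
  by_cases heq : Set.range (itin α.1 q) = (fun z => Prod.fst ∘ z) '' Set.range (itin γ.1 p)
  · let i : C(ℕ × ℕ, ℕ) := ⟨Prod.fst, continuous_fst⟩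
    rw [← range_itin_comp γ.1 p (i.comp p) Prod.fst fun _ => rfl] at heq
    obtain ⟨δ, hδU, t, ht, hta, hcompat⟩ := exists_amalgam α γ (hU.mem_nhds hαU) q p i heq
    refine ⟨δ, hδU, Or.inl ⟨(⟨Prod.snd, continuous_snd⟩ : C(ℕ × ℕ, ℕ)).comp (p.comp t), ?_⟩⟩
    have hq : q.prodMk ((⟨Prod.snd, continuous_snd⟩ : C(ℕ × ℕ, ℕ)).comp (p.comp t)) =
        p.comp t := by
      ext x : 1
      exact Prod.ext (hcompat x).symm rfl
    rw [hq]
    exact eventually_range_itin_factor ht hta hp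
  · refine ⟨α, hαU, Or.inr ?_⟩
    filter_upwards [hα] with β hβ
    rwa [hβ]

theorem hasSTRP_of_dense_locConstAt {G : Type} [Group G] [Countable G]
    (h : ∀ q : C(Cantor, ℕ), Dense {α : ActSpace G | LocConstAt q α})
    (h' : ∀ q : C(Cantor, ℕ × ℕ), Dense {α : ActSpace G | LocConstAt q α}) : HasSTRP G := by
  have := polishSpace_actSpace G
  have := countable_continuousMap_cantor ℕ
  have := countable_continuousMap_cantor (ℕ × ℕ)
  have : Nonempty (ActSpace G) := ⟨⟨fun _ => ContinuousMap.id _, rfl, fun _ _ => rfl⟩⟩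
  let Λ : Set (Set (G → ℕ × ℕ)) :=
    {S | ∃ p : C(Cantor, ℕ × ℕ), ∃ γ : ActSpace G, LocConstAt p γ ∧ Set.range (itin γ.1 p) = S}
  have hΛ : Λ.Countable := by
    refine (Set.countable_range fun z : C(Cantor, ℕ × ℕ) × ℕ =>
      Set.range (itin (TopologicalSpace.denseSeq (ActSpace G) z.2).1 z.1)).mono ?_
    rintro _ ⟨p, γ, hγ, rfl⟩
    obtain ⟨_, hβ, n, rfl⟩ := mem_closure_iff_nhds.1
      (TopologicalSpace.denseRange_denseSeq (ActSpace G) γ) _ hγ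
    exact ⟨(p, n), hβ⟩
  have hres : ({α : ActSpace G | ∀ p : C(Cantor, ℕ × ℕ), LocConstAt p α} ∩
      {α | ∀ q : C(Cantor, ℕ), ∀ S ∈ Λ, α ∈ extensionSet q S}) ∈ residual (ActSpace G) := by
    refine Filter.inter_mem ?_ ?_
    · exact eventually_countable_forall.2 fun p =>
        residual_of_dense_open (isOpen_locConstAt p) (h' p)
    · refine eventually_countable_forall.2 fun q => (eventually_countable_ball hΛ).2 ?_
      rintro _ ⟨p, γ, hγ, rfl⟩
      exact residual_of_dense_open (isOpen_extensionSet q _) (dense_extensionSet h q hγ)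
  obtain ⟨α, hα⟩ := (dense_of_mem_residual hres).nonempty
  refine ⟨α, Filter.mem_of_superset hres fun β hβ => ?_⟩
  have key : ∀ α β : ActSpace G, (∀ p : C(Cantor, ℕ × ℕ), LocConstAt p α) →
      (∀ q : C(Cantor, ℕ), ∀ S ∈ Λ, β ∈ extensionSet q S) →
      ∀ q q' : C(Cantor, ℕ), Set.range (itin α.1 q) = Set.range (itin β.1 q') →
      ∀ p : C(Cantor, ℕ), ∃ p' : C(Cantor, ℕ),
        Set.range (itin α.1 (q.prodMk p)) = Set.range (itin β.1 (q'.prodMk p')) := by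
    intro α β hα hβ q q' hq p
    rcases hβ q' _ ⟨q.prodMk p, α, hα _, rfl⟩ with ⟨p', hp'⟩ | hne
    · exact ⟨p', hp'.self_of_nhds.symm⟩
    · refine absurd ?_ hne.self_of_nhds
      rw [← hq]
      exact range_itin_comp α.1 (q.prodMk p) q Prod.fst fun _ => rfl
  have hconst : ∀ α : ActSpace G,
      Set.range (itin α.1 (ContinuousMap.const _ 0)) = {fun _ => (0 : ℕ)} := fun _ =>
    (Set.range_const : Set.range (fun (_ : Cantor) (_ : G) => (0 : ℕ)) = _)
  obtain ⟨φ, hφ, -⟩ := exists_homeomorph_of_extension α.2 β.2 countablySeparated_cantor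
    countablySeparated_cantor (key α β hα.1 hβ.2) (key β α hβ.1 hα.2)
    (ContinuousMap.const _ 0) (ContinuousMap.const _ 0) ((hconst α).trans (hconst β).symm)
  refine ⟨φ, fun g => funext fun x => ?_⟩
  simp [hφ]

/-- A countable group `G` has the strong topological Rokhlin property
iff for every finite alphabet `A` with at least two elements, the projectively isolated
subshifts are dense in the space of subshifts of `A^G`. -/
theorem strp_iff_dense_projIsolated (G : Type) [Group G] [Countable G] :
    HasSTRP G ↔
      ∀ (A : Type) (_ : Fintype A) (_ : Nontrivial A) (X : Set (G → A)),
        IsSubshift G A X → ∀ F : Finset G,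
          ∃ X' : Set (G → A), IsSubshift G A X' ∧ ProjIsolated G A X' ∧
            patterns F X' = patterns F X := by
  constructor
  · intro h A _ _ X hX F
    let _ : TopologicalSpace A := ⊥
    have : DiscreteTopology A := ⟨rfl⟩
    exact exists_projIsolated_of_dense (fun p => dense_locConstAt_of_hasSTRP h p) hX F
  · intro h
    have hfin : ∀ (A : Type) [Fintype A] [Nontrivial A] [TopologicalSpace A] [DiscreteTopology A]
        (p : C(Cantor, A)), Dense {α : ActSpace G | LocConstAt p α} := fun A _ _ _ _ p =>
      dense_locConstAt_of_projIsolated h p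
    exact hasSTRP_of_dense_locConstAt (fun q => dense_locConstAt_of_finite hfin q)
      fun q => dense_locConstAt_of_finite hfin q
end

section
/- Let G be a countable group. Suppose there exist a finite set A with at least two elements, a subshift X ⊆ A^G, and a finite set F ⊆ G such that no projectively isolated subshift X' ⊆ A^G satisfies X'_F = X_F. Then every conjugacy class in Act_G(𝒞) is meager; in particular, G does not have the strong topological Rokhlin property. -/
open Topology

/-! ### Cantor space -/

/-- A closed subset of `𝒞 × 𝒞` missing the diagonal is separated from it by finitely many
coordinates. -/
theorem exists_index_of_disjoint_diagonal {D : Set (Cantor × Cantor)} (hD : IsClosed D)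
    (hdiag : ∀ x, (x, x) ∉ D) : ∃ N : ℕ, ∀ p ∈ D, ∃ i < N, p.1 i ≠ p.2 i := by
  by_contra! hcon
  let t : ℕ → Set (Cantor × Cantor) := fun N => D ∩ {p | ∀ i < N, p.1 i = p.2 i}
  have hcl : ∀ N, IsClosed (t N) := by
    intro N
    refine hD.inter ?_
    simp only [Set.ofPred_forall]
    exact isClosed_iInter fun i => isClosed_iInter fun _ =>
      isClosed_eq (by fun_prop) (by fun_prop)
  obtain ⟨p, hp⟩ := IsCompact.nonempty_iInter_of_sequence_nonempty_isCompact_isClosed t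
    (fun N p hp => ⟨hp.1, fun i hi => hp.2 i (by omega)⟩)
    (fun N => by obtain ⟨p, hp, h⟩ := hcon N; exact ⟨p, hp, h⟩)
    (hcl 0).isCompact hcl
  rw [Set.mem_iInter] at hp
  have hpp : p.1 = p.2 := funext fun i => (hp (i + 1)).2 i (Nat.lt_succ_self i)
  apply hdiag p.1
  have := (hp 0).1
  rwa [show p = (p.1, p.1) from Prod.ext rfl hpp.symm] at this

/-- A continuous map from `𝒞` to a discrete space depends on finitely many coordinates. -/
theorem exists_depends_on_initial_bits {Q : Type*} [TopologicalSpace Q] [DiscreteTopology Q]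
    {s : Cantor → Q} (hs : Continuous s) :
    ∃ N : ℕ, ∀ x y : Cantor, (∀ i < N, x i = y i) → s x = s y := by
  have hD : IsClosed {p : Cantor × Cantor | s p.1 ≠ s p.2} := by
    have : Continuous fun p : Cantor × Cantor => (s p.1, s p.2) := by fun_prop
    exact (isClosed_discrete {p : Q × Q | p.1 ≠ p.2}).preimage this
  obtain ⟨N, hN⟩ := exists_index_of_disjoint_diagonal hD (by simp)
  refine ⟨N, fun x y hxy => ?_⟩
  by_contra hne
  obtain ⟨i, hi, h⟩ := hN (x, y) hne
  exact h (hxy i hi)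

/-- A neighborhood in `C(𝒞, 𝒞)` contains all maps agreeing with the center on finitely many
coordinates. -/
theorem exists_initial_bits_of_mem_nhds {f : C(Cantor, Cantor)} {U : Set C(Cantor, Cantor)}
    (hU : U ∈ 𝓝 f) :
    ∃ N : ℕ, ∀ f' : C(Cantor, Cantor), (∀ x, ∀ i < N, f' x i = f x i) → f' ∈ U := by
  let b : ℕ → Set C(Cantor, Cantor) := fun N => {f' | ∀ x, ∀ i < N, f' x i = f x i}
  have hanti : Antitone b := fun m n hmn f' hf' x i hi => hf' x i (hi.trans_le hmn)
  have hle : ⨅ N, Filter.principal (b N) ≤ 𝓝 f := by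
    rw [ContinuousMap.nhds_compactOpen]
    refine le_iInf₂ fun K hK => le_iInf₂ fun V hV => le_iInf fun hKV => ?_
    have hcl : IsClosed ((f '' K) ×ˢ Vᶜ) :=
      (hK.image f.continuous).isClosed.prod hV.isClosed_compl
    obtain ⟨N, hN⟩ := exists_index_of_disjoint_diagonal hcl (by
      rintro _ ⟨⟨x, hx, rfl⟩, hxV⟩
      exact hxV (hKV hx))
    refine (iInf_le _ N).trans (Filter.principal_mono.2 ?_)
    intro f' hf' x hx
    by_contra hxV
    obtain ⟨i, hi, h⟩ := hN (f x, f' x) ⟨⟨x, hx, rfl⟩, hxV⟩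
    exact h (hf' x i hi).symm
  have := hle hU
  rw [Filter.mem_iInf_of_directed
    (fun m n : ℕ => ⟨max m n, Filter.principal_mono.2 (hanti (le_max_left m n)),
      Filter.principal_mono.2 (hanti (le_max_right m n))⟩)] at this
  obtain ⟨N, hN⟩ := this
  exact ⟨N, fun f' hf' => hN hf'⟩

/-! ### Zero-dimensional compact spaces times a Cantor space -/

/-- The space admits countably many continuous two-valued functions separating points. -/
def HasSeparatingBits (K : Type*) [TopologicalSpace K] : Prop :=
  ∃ t : ℕ → K → Bool, (∀ n, Continuous (t n)) ∧ ∀ x y, (∀ n, t n x = t n y) → x = y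

theorem HasSeparatingBits.of_countable {K ι : Type*} [TopologicalSpace K] [Countable ι]
    (t : ι → K → Bool) (ht : ∀ i, Continuous (t i))
    (hinj : ∀ x y, (∀ i, t i x = t i y) → x = y) : HasSeparatingBits K := by
  obtain ⟨f, hf⟩ := Countable.exists_injective_nat ι
  refine ⟨Function.extend f t fun _ _ => false, fun n => ?_, fun x y h => hinj x y fun i => ?_⟩
  · by_cases hn : ∃ i, f i = n
    · obtain ⟨i, rfl⟩ := hn
      rw [hf.extend_apply]
      exact ht i
    · rw [Function.extend_apply' _ _ _ hn]
      exact continuous_const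
  · simpa [hf.extend_apply] using h (f i)

section Coding

variable {K Q : Type*} [TopologicalSpace K] [TopologicalSpace Q]

/-- The value of `q` together with the first `n` bits. -/
def bitKey (t : ℕ → K → Bool) (q : K → Q) (n : ℕ) (k : K) : Q × (Fin n → Bool) :=
  (q k, fun i => t i k)

/-- The keys of length `n` after which both bits occur. -/
def branchKeys (t : ℕ → K → Bool) (q : K → Q) (n : ℕ) : Set (Q × (Fin n → Bool)) :=
  {v | ∃ k k', bitKey t q n k = v ∧ bitKey t q n k' = v ∧ t n k ≠ t n k'}

/-- Prepend a bit to a binary sequence. -/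
def consBit (b : Bool) (c : ℕ → Bool) : ℕ → Bool
  | 0 => b
  | n + 1 => c n

open Classical in
/-- Write the `n`-th bit of `k` in front of the `n`-th binary sequence whenever that bit is
not determined by the previous ones. -/
noncomputable def bitCode (t : ℕ → K → Bool) (q : K → Q) (p : K × (ℕ → ℕ → Bool)) :
    ℕ → ℕ → Bool :=
  fun n => if bitKey t q n p.1 ∈ branchKeys t q n then consBit (t n p.1) (p.2 n) else p.2 n

theorem continuous_consBit : Continuous fun p : Bool × (ℕ → Bool) => consBit p.1 p.2 := by
  refine continuous_pi fun n => ?_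
  cases n with
  | zero => exact continuous_fst
  | succ n => exact (continuous_apply n).comp continuous_snd

omit [TopologicalSpace K] [TopologicalSpace Q] in
theorem bitKey_eq_iff {t : ℕ → K → Bool} {q : K → Q} {n : ℕ} {k k' : K} :
    bitKey t q n k = bitKey t q n k' ↔ q k = q k' ∧ ∀ i < n, t i k = t i k' := by
  simp [bitKey, funext_iff, Fin.forall_iff]

theorem continuous_bitCode [DiscreteTopology Q] {t : ℕ → K → Bool} (ht : ∀ n, Continuous (t n))
    {q : K → Q} (hq : Continuous q) : Continuous (bitCode t q) := by
  classical
  refine continuous_pi fun n => ?_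
  have hkey : Continuous fun p : K × (ℕ → ℕ → Bool) => bitKey t q n p.1 := by
    unfold bitKey
    fun_prop
  have hclopen : IsClopen {p : K × (ℕ → ℕ → Bool) | bitKey t q n p.1 ∈ branchKeys t q n} :=
    (isClopen_discrete (branchKeys t q n)).preimage hkey
  refine continuous_if ?_ ?_ ?_
  · rw [hclopen.frontier_eq]
    simp
  · have := continuous_consBit.comp
      (show Continuous fun p : K × (ℕ → ℕ → Bool) => (t n p.1, p.2 n) by fun_prop)
    exact this.continuousOn
  · exact Continuous.continuousOn (by fun_prop)

omit [TopologicalSpace K] [TopologicalSpace Q] in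
theorem bitCode_injective {t : ℕ → K → Bool} (hinj : ∀ x y, (∀ n, t n x = t n y) → x = y)
    {q : K → Q} {p p' : K × (ℕ → ℕ → Bool)} (hq : q p.1 = q p'.1)
    (h : bitCode t q p = bitCode t q p') : p = p' := by
  have hbits : ∀ n, t n p.1 = t n p'.1 := by
    intro n
    induction n using Nat.strong_induction_on with
    | _ n ih =>
      have hkey : bitKey t q n p.1 = bitKey t q n p'.1 := bitKey_eq_iff.2 ⟨hq, ih⟩
      by_cases hb : bitKey t q n p.1 ∈ branchKeys t q n
      · have h0 := congrFun (congrFun h n) 0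
        simpa [bitCode, hkey ▸ hb, hb, consBit] using h0
      · by_contra hne
        exact hb ⟨p.1, p'.1, rfl, hkey.symm, hne⟩
  have hk : p.1 = p'.1 := hinj _ _ hbits
  refine Prod.ext hk (funext fun n => ?_)
  have hn := congrFun h n
  by_cases hb : bitKey t q n p'.1 ∈ branchKeys t q n
  · funext m
    simpa [bitCode, hk, hb, consBit] using congrFun hn (m + 1)
  · simpa [bitCode, hk, hb] using hn

theorem exists_bitCode_eq [CompactSpace K] [DiscreteTopology Q] {t : ℕ → K → Bool}
    (ht : ∀ n, Continuous (t n)) {q : K → Q} (hq : Continuous q) (k₀ : K) (o : ℕ → ℕ → Bool) :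
    ∃ p, q p.1 = q k₀ ∧ bitCode t q p = o := by
  let good : ℕ → K → Prop := fun n k => bitKey t q n k ∈ branchKeys t q n → t n k = o n 0
  let S : ℕ → Set K := fun N => {k | q k = q k₀ ∧ ∀ n < N, good n k}
  have hgood : ∀ n, IsClosed {k | good n k} := by
    intro n
    have hkey : Continuous (bitKey t q n) := by
      unfold bitKey
      fun_prop
    have h1 : IsClopen {k | bitKey t q n k ∈ branchKeys t q n} :=
      (isClopen_discrete _).preimage hkey
    have h2 : IsClosed {k | t n k = o n 0} := isClosed_eq (ht n) continuous_const
    exact isClosed_imp h1.isOpen h2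
  have hcl : ∀ N, IsClosed (S N) := by
    intro N
    refine (isClosed_eq hq continuous_const).inter ?_
    change IsClosed {k | ∀ n < N, good n k}
    simp only [Set.ofPred_forall]
    exact isClosed_iInter fun i => isClosed_iInter fun _ => hgood i
  have hne : ∀ N, (S N).Nonempty := by
    intro N
    induction N with
    | zero => exact ⟨k₀, rfl, by simp⟩
    | succ N ih =>
      obtain ⟨k, hkq, hk⟩ := ih
      by_cases hN : good N k
      · refine ⟨k, hkq, fun n hn => ?_⟩
        rcases Nat.lt_succ_iff_lt_or_eq.1 hn with h | rfl
        exacts [hk n h, hN]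
      · obtain ⟨hb, hne⟩ := Classical.not_imp.1 hN
        obtain ⟨a, a', ha, ha', haa⟩ := id hb
        obtain ⟨k', hk', hk'N⟩ : ∃ k', bitKey t q N k' = bitKey t q N k ∧ t N k' = o N 0 := by
          by_cases h : t N a = o N 0
          · exact ⟨a, ha, h⟩
          · refine ⟨a', ha', ?_⟩
            revert h haa
            cases t N a <;> cases t N a' <;> cases o N 0 <;> simp
        have hagree := bitKey_eq_iff.1 hk'
        refine ⟨k', hagree.1.trans hkq, fun n hn => ?_⟩
        rcases Nat.lt_succ_iff_lt_or_eq.1 hn with h | rfl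
        · have hkey : bitKey t q n k' = bitKey t q n k :=
            bitKey_eq_iff.2 ⟨hagree.1, fun i hi => hagree.2 i (hi.trans h)⟩
          intro hb'
          rw [hagree.2 n h]
          exact hk n h (hkey ▸ hb')
        · exact fun _ => hk'N
  obtain ⟨k, hk⟩ := IsCompact.nonempty_iInter_of_sequence_nonempty_isCompact_isClosed S
    (fun N k hk => ⟨hk.1, fun n hn => hk.2 n (by omega)⟩) hne (hcl 0).isCompact hcl
  rw [Set.mem_iInter] at hk
  classical
  refine ⟨(k, fun n => if bitKey t q n k ∈ branchKeys t q n then fun m => o n (m + 1) else o n),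
    (hk 0).1, ?_⟩
  funext n
  by_cases hb : bitKey t q n k ∈ branchKeys t q n
  · funext m
    cases m with
    | zero => simpa [bitCode, hb, consBit] using (hk (n + 1)).2 n (Nat.lt_succ_self n) hb
    | succ m => simp [bitCode, hb, consBit]
  · simp [bitCode, hb]

/-- A fibred form of Brouwer's characterization of the Cantor space. -/
theorem exists_homeomorph_range_prod [CompactSpace K] [DiscreteTopology Q]
    (hK : HasSeparatingBits K) {q : K → Q} (hq : Continuous q) :
    ∃ e : K × (ℕ → ℕ → Bool) ≃ₜ Set.range q × (ℕ → ℕ → Bool), ∀ p, ((e p).1 : Q) = q p.1 := by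
  obtain ⟨t, ht, hinj⟩ := hK
  let f : K × (ℕ → ℕ → Bool) → Set.range q × (ℕ → ℕ → Bool) :=
    fun p => (⟨q p.1, p.1, rfl⟩, bitCode t q p)
  have hf : Continuous f :=
    ((hq.comp continuous_fst).subtype_mk _).prodMk (continuous_bitCode ht hq)
  have hbij : Function.Bijective f := by
    constructor
    · intro p p' h
      exact bitCode_injective hinj (congrArg Subtype.val (congrArg Prod.fst h)) (congrArg Prod.snd h)
    · rintro ⟨⟨_, k₀, rfl⟩, o⟩
      obtain ⟨p, hp, ho⟩ := exists_bitCode_eq ht hq k₀ o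
      exact ⟨p, Prod.ext (Subtype.ext hp) ho⟩
  exact ⟨Continuous.homeoOfEquivCompactToT2 (f := Equiv.ofBijective f hbij) hf, fun p => rfl⟩

end Coding

/-- The Cantor space splits off any finite number of initial coordinates. -/
theorem exists_homeomorph_initial_bits_prod (N : ℕ) :
    ∃ e : Cantor ≃ₜ ({i : ℕ // i < N} → Bool) × (ℕ → ℕ → Bool),
      ∀ x i, (e x).1 i = x i := by
  have : Infinite {i : ℕ // ¬ i < N} :=
    Infinite.of_injective (fun n : ℕ => (⟨N + n, by omega⟩ : {i : ℕ // ¬ i < N}))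
      (fun a b hab => by simpa using hab)
  obtain ⟨u⟩ := nonempty_equiv_of_countable (α := {i : ℕ // ¬ i < N}) (β := ℕ × ℕ)
  let v : ({i : ℕ // ¬ i < N} → Bool) ≃ₜ (ℕ → ℕ → Bool) :=
    { toFun := fun c m n => c (u.symm (m, n))
      invFun := fun c i => c (u i).1 (u i).2
      left_inv := fun c => by funext i; simp
      right_inv := fun c => by funext m n; simp
      continuous_toFun := by fun_prop
      continuous_invFun := by fun_prop }
  exact ⟨(Homeomorph.piEquivPiSubtypeProd (· < N) fun _ => Bool).trans
    ((Homeomorph.refl _).prodCongr v), fun x i => rfl⟩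

/-- Two discrete-valued continuous maps with the same range, one of them on `𝒞`, are matched
by a homeomorphism after multiplying the other domain by a Cantor space. -/
theorem exists_homeomorph_cantor {K Q : Type*} [TopologicalSpace K] [CompactSpace K]
    [TopologicalSpace Q] [DiscreteTopology Q] (hK : HasSeparatingBits K)
    {q : K → Q} (hq : Continuous q) {s : Cantor → Q} (hs : Continuous s)
    (hqs : Set.range q = Set.range s) :
    ∃ φ : K × (ℕ → ℕ → Bool) ≃ₜ Cantor, ∀ p, s (φ p) = q p.1 := by
  obtain ⟨N, hN⟩ := exists_depends_on_initial_bits hs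
  let ext : ({i : ℕ // i < N} → Bool) → Cantor := fun v n => if h : n < N then v ⟨n, h⟩ else false
  obtain ⟨e₁, he₁⟩ := exists_homeomorph_initial_bits_prod N
  obtain ⟨e₂, he₂⟩ := exists_homeomorph_range_prod hK hq
  have hV : HasSeparatingBits ({i : ℕ // i < N} → Bool) :=
    .of_countable (fun i v => v i) (fun i => continuous_apply i) fun _ _ h => funext h
  obtain ⟨e₃, he₃⟩ := exists_homeomorph_range_prod hV
    (q := fun v => s (ext v)) continuous_of_discreteTopology
  have hse : ∀ x, s (ext (e₁ x).1) = s x := fun x =>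
    hN _ _ fun i hi => by simp [ext, hi, he₁]
  have hrange : Set.range q = Set.range fun v => s (ext v) := by
    rw [hqs]
    ext a
    constructor
    · rintro ⟨x, rfl⟩
      exact ⟨_, hse x⟩
    · rintro ⟨v, rfl⟩
      exact ⟨_, rfl⟩
  let φ := e₂.trans
    (((Homeomorph.setCongr hrange).prodCongr (Homeomorph.refl _)).trans (e₃.symm.trans e₁.symm))
  refine ⟨φ, fun p => ?_⟩
  have h1 : e₃ (e₁ (φ p)) = ((Homeomorph.setCongr hrange) (e₂ p).1, (e₂ p).2) := by
    simp only [φ, Homeomorph.trans_apply, Homeomorph.apply_symm_apply]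
    rfl
  rw [← hse, ← he₃, h1, ← he₂]
  rfl

/-! ### Symbolic codings of actions -/

section Actions

variable {G : Type} [Group G]

theorem ActSpace.map_mul (β : ActSpace G) (g h : G) (x : Cantor) :
    β.1 (g * h) x = β.1 g (β.1 h x) := by
  rw [β.2.2]
  rfl

theorem ActSpace.map_one (β : ActSpace G) (x : Cantor) : β.1 1 x = x := by
  rw [β.2.1]
  rfl

/-- The itinerary of `x` under the action `β` with respect to the partition `P`. -/
def itinerary {A : Type} (β : ActSpace G) (P : Cantor → A) (x : Cantor) : G → A :=
  fun g => P (β.1 g⁻¹ x)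

theorem shift_itinerary {A : Type} (β : ActSpace G) (P : Cantor → A) (h : G) (x : Cantor) :
    shift h (itinerary β P x) = itinerary β P (β.1 h x) := by
  funext g
  simp [shift, itinerary, ← ActSpace.map_mul]

theorem shift_mul {A : Type} (g h : G) (x : G → A) : shift (g * h) x = shift g (shift h x) := by
  funext k
  simp [shift, mul_assoc]

theorem shift_one {A : Type} (x : G → A) : shift (1 : G) x = x := by
  funext k
  simp [shift]

variable {A : Type} [TopologicalSpace A]

theorem continuous_shift (g : G) : Continuous (shift g : (G → A) → G → A) := by
  unfold shift
  fun_prop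

theorem continuous_itinerary (β : ActSpace G) {P : Cantor → A} (hP : Continuous P) :
    Continuous (itinerary β P) := by
  unfold itinerary
  fun_prop

variable [DiscreteTopology A]

theorem isSubshift_iff {X : Set (G → A)} :
    IsSubshift G A X ↔ IsClosed X ∧ ∀ g : G, ∀ x ∈ X, shift g x ∈ X := by
  obtain rfl := DiscreteTopology.eq_bot (α := A)
  rfl

theorem isClosed_range_itinerary (β : ActSpace G) {P : Cantor → A} (hP : Continuous P) :
    IsClosed (Set.range (itinerary β P)) :=
  (isCompact_range (continuous_itinerary β hP)).isClosed

theorem isSubshift_range_itinerary (β : ActSpace G) {P : Cantor → A} (hP : Continuous P) :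
    IsSubshift G A (Set.range (itinerary β P)) := by
  refine isSubshift_iff.2 ⟨isClosed_range_itinerary β hP, ?_⟩
  rintro g _ ⟨x, rfl⟩
  exact ⟨_, (shift_itinerary β P g x).symm⟩

omit [Group G] [DiscreteTopology A] in
theorem subset_of_patterns_subset {Y Y' : Set (G → A)} (hY' : IsClosed Y')
    (h : ∀ E : Finset G, patterns E Y ⊆ patterns E Y') : Y ⊆ Y' := by
  intro y hy
  rw [← hY'.closure_eq, mem_closure_iff]
  intro O hO hyO
  obtain ⟨E, u, hu, hEu⟩ := isOpen_pi_iff.1 hO y hyO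
  obtain ⟨y', hy', hyy'⟩ := h E ⟨y, hy, rfl⟩
  refine ⟨y', hEu fun g hg => ?_, hy'⟩
  have : y' g = y g := congrFun hyy' ⟨g, hg⟩
  rw [this]
  exact (hu g hg).2

omit [Group G] in
theorem HasSeparatingBits.subtype_shift [Finite A] [Countable G]
    (X : Set (G → A)) : HasSeparatingBits X := by
  classical
  refine .of_countable (ι := G × A) (fun i x => decide ((x : G → A) i.1 = i.2)) (fun i => ?_)
    fun x y h => Subtype.ext (funext fun g => ?_)
  · exact (continuous_of_discreteTopology (f := fun a : A => decide (a = i.2))).comp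
      ((continuous_apply i.1).comp continuous_subtype_val)
  · simpa using h (g, (y : G → A) g)

theorem eventually_comp_eq_s1 [Finite A] (β : ActSpace G) {P : Cantor → A} (hP : Continuous P)
    (g : G) : ∀ᶠ β' : ActSpace G in 𝓝 β, ∀ x, P (β'.1 g x) = P (β.1 g x) := by
  have hmap : ∀ a : A, ∀ᶠ f : C(Cantor, Cantor) in 𝓝 (β.1 g),
      Set.MapsTo f ((fun x => P (β.1 g x)) ⁻¹' {a}) (P ⁻¹' {a}) := fun a =>
    ContinuousMap.eventually_mapsTo
      ((isClosed_discrete {a}).preimage (by fun_prop)).isCompact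
      ((isOpen_discrete {a}).preimage hP) fun x hx => hx
  have hcont : Continuous fun β' : ActSpace G => β'.1 g :=
    (continuous_apply g).comp continuous_subtype_val
  filter_upwards [(hcont.tendsto β).eventually (Filter.eventually_all.2 hmap)] with β' h x
  exact h _ (show x ∈ _ ⁻¹' {P (β.1 g x)} from rfl)

theorem eventually_patterns_eq [Finite A] (β : ActSpace G) {P : Cantor → A} (hP : Continuous P)
    (E : Finset G) : ∀ᶠ β' in 𝓝 β,
      patterns E (Set.range (itinerary β' P)) = patterns E (Set.range (itinerary β P)) := by
  have : ∀ᶠ β' : ActSpace G in 𝓝 β, ∀ g : E, ∀ x, P (β'.1 (g : G)⁻¹ x) = P (β.1 (g : G)⁻¹ x) :=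
    Filter.eventually_all.2 fun g => eventually_comp_eq_s1 β hP _
  filter_upwards [this] with β' h
  unfold patterns
  rw [← Set.range_comp, ← Set.range_comp]
  congr 1
  funext x g
  exact h g x

theorem isClosed_setOf_range_itinerary_eq [Finite A] {P : Cantor → A} (hP : Continuous P)
    {X : Set (G → A)} (hX : IsClosed X) :
    IsClosed {β : ActSpace G | Set.range (itinerary β P) = X} := by
  rw [← isOpen_compl_iff, isOpen_iff_mem_nhds]
  intro β hβ
  obtain ⟨E, hE⟩ : ∃ E, patterns E (Set.range (itinerary β P)) ≠ patterns E X := by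
    by_contra! hcon
    exact hβ ((subset_of_patterns_subset hX fun E => (hcon E).le).antisymm
      (subset_of_patterns_subset (isClosed_range_itinerary β hP) fun E => (hcon E).ge))
  filter_upwards [eventually_patterns_eq β hP E] with β' h heq
  exact hE (by rw [← h, show Set.range (itinerary β' P) = X from heq])

omit A [TopologicalSpace A] [DiscreteTopology A] in
/-- Neighborhoods in the space of actions are determined by finitely many group elements and
finitely many coordinates. -/
theorem exists_cylinder_of_mem_nhds {β : ActSpace G} {U : Set (ActSpace G)} (hU : U ∈ 𝓝 β) :
    ∃ (E : Finset G) (N : ℕ), ∀ β' : ActSpace G,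
      (∀ g ∈ E, ∀ x, ∀ i < N, β'.1 g x i = β.1 g x i) → β' ∈ U := by
  rw [nhds_subtype_eq_comap, Filter.mem_comap] at hU
  obtain ⟨V, hV, hVU⟩ := hU
  rw [nhds_pi, Filter.mem_pi] at hV
  obtain ⟨I, hI, t, ht, hIt⟩ := hV
  choose n hn using fun g => exists_initial_bits_of_mem_nhds (ht g)
  refine ⟨hI.toFinset, hI.toFinset.sup n, fun β' h => hVU (hIt fun g hg => hn g _ ?_)⟩
  have hg' : g ∈ hI.toFinset := by simpa using hg
  exact fun x i hi => h g hg' x i (hi.trans_le (Finset.le_sup (f := n) hg'))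

omit A [TopologicalSpace A] [DiscreteTopology A] in
/-- Every continuous action on a compact zero-dimensional space is, after taking the product
with a trivial action, conjugate to an action on `𝒞`, by a conjugacy matching prescribed
discrete-valued maps. -/
theorem exists_action_of_action {K Q : Type} [TopologicalSpace K] [CompactSpace K]
    [TopologicalSpace Q] [DiscreteTopology Q] (hK : HasSeparatingBits K)
    (a : G → K → K) (ha : ∀ g, Continuous (a g)) (ha_one : ∀ k, a 1 k = k)
    (ha_mul : ∀ g h k, a (g * h) k = a g (a h k))
    {q : K → Q} (hq : Continuous q) {s : Cantor → Q} (hs : Continuous s)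
    (hqs : Set.range q = Set.range s) :
    ∃ (β : ActSpace G) (φ : K × (ℕ → ℕ → Bool) ≃ₜ Cantor),
      (∀ g k c, β.1 g (φ (k, c)) = φ (a g k, c)) ∧ ∀ p, s (φ p) = q p.1 := by
  obtain ⟨φ, hφ⟩ := exists_homeomorph_cantor hK hq hs hqs
  let β : G → C(Cantor, Cantor) := fun g =>
    ⟨fun y => φ (a g (φ.symm y).1, (φ.symm y).2), by
      have := ha g
      fun_prop⟩
  refine ⟨⟨β, ?_, ?_⟩, φ, fun g k c => ?_, hφ⟩
  · ext y : 1
    simp [β, ha_one]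
  · intro g h
    ext y : 1
    simp [β, ha_mul]
  · simp [β]

variable [Finite A] [Countable G]

/-- Actions having a factor inside `A^G` with the `F`-patterns of a given subshift are dense. -/
theorem dense_setOf_patterns_eq {X : Set (G → A)} (hX : IsSubshift G A X) (hne : X.Nonempty)
    (F : Finset G) :
    Dense {β : ActSpace G | ∃ P : Cantor → A, Continuous P ∧
      patterns F (Set.range (itinerary β P)) = patterns F X} := by
  classical
  rw [isSubshift_iff] at hX
  intro β
  rw [mem_closure_iff_nhds]
  intro U hU
  obtain ⟨E, N, hE⟩ := exists_cylinder_of_mem_nhds hU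
  have : CompactSpace X := isCompact_iff_compactSpace.1 hX.1.isCompact
  let R : Cantor → Fin N → Bool := fun x i => x i
  have hR : Continuous R := by fun_prop
  let E' : Finset G := insert 1 (E.image (·⁻¹))
  let s : Cantor → E' → Fin N → Bool := fun x g => itinerary β R x g
  have hs : Continuous s := continuous_pi fun g =>
    (continuous_apply (g : G)).comp (continuous_itinerary β hR)
  have hbits : HasSeparatingBits (Cantor × X) := by
    obtain ⟨t, ht, hinj⟩ := HasSeparatingBits.subtype_shift X
    refine .of_countable (ι := ℕ ⊕ ℕ)
      (Sum.elim (fun n p => p.1 n) fun n p => t n p.2) ?_ fun p p' h => ?_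
    · rintro (n | n)
      · exact (continuous_apply n).comp continuous_fst
      · exact (ht n).comp continuous_snd
    · exact Prod.ext (funext fun n => h (.inl n)) (hinj _ _ fun n => h (.inr n))
  obtain ⟨z₀, hz₀⟩ := hne
  obtain ⟨β', φ, hβ', hφ⟩ := exists_action_of_action hbits
    (fun g p => (β.1 g p.1, ⟨shift g p.2.1, hX.2 g _ p.2.2⟩))
    (fun g => by
      have := continuous_shift (A := A) g
      fun_prop)
    (fun p => by simp [ActSpace.map_one, shift_one])
    (fun g h p => by simp [ActSpace.map_mul, shift_mul])
    (q := fun p => s p.1) (hs.comp continuous_fst) hs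
    (by
      ext v
      constructor
      · rintro ⟨p, rfl⟩
        exact ⟨_, rfl⟩
      · rintro ⟨x, rfl⟩
        exact ⟨(x, ⟨z₀, hz₀⟩), rfl⟩)
  refine ⟨β', hE β' ?_, fun y => (φ.symm y).1.2.1 1,
    (continuous_apply (1 : G)).comp (continuous_subtype_val.comp
      (continuous_snd.comp (continuous_fst.comp φ.symm.continuous))), congrArg _ ?_⟩
  · intro g hg y i hi
    obtain ⟨⟨⟨x, z⟩, c⟩, rfl⟩ := φ.surjective y
    rw [hβ']
    have h1 := congrFun (congrFun (hφ ((β.1 g x, ⟨shift g z.1, hX.2 g _ z.2⟩), c))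
      ⟨1, by simp [E']⟩) ⟨i, hi⟩
    have h2 := congrFun (congrFun (hφ ((x, z), c)) ⟨g⁻¹, by simp [E', hg]⟩) ⟨i, hi⟩
    simp only [s, itinerary, R, inv_one, inv_inv, ActSpace.map_one] at h1 h2
    rw [h1, h2]
  · ext w
    constructor
    · rintro ⟨y, rfl⟩
      obtain ⟨⟨⟨x, z⟩, c⟩, rfl⟩ := φ.surjective y
      convert z.2 using 1
      funext g
      simp [itinerary, hβ', shift]
    · intro hw
      refine ⟨φ ((fun _ => false, ⟨w, hw⟩), fun _ _ => false), ?_⟩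
      funext g
      simp [itinerary, hβ', shift]

/-- A subshift that is a factor, via a fixed partition, of all actions in a nonempty open set is
projectively isolated. -/
theorem projIsolated_of_mem_nhds [Nontrivial A] {P : Cantor → A} (hP : Continuous P)
    {X : Set (G → A)} {β : ActSpace G}
    (hU : {β' : ActSpace G | Set.range (itinerary β' P) = X} ∈ 𝓝 β) : ProjIsolated G A X := by
  classical
  obtain ⟨E, N, hE⟩ := exists_cylinder_of_mem_nhds hU
  have hβ : Set.range (itinerary β P) = X := mem_of_mem_nhds (s := {β' : ActSpace G | Set.range (itinerary β' P) = X}) hU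
  let B : Type := (Fin N → Bool) × A
  let R : Cantor → B := fun x => (fun i => x i, P x)
  have hR : Continuous R := by fun_prop
  let E' : Finset G := insert 1 (E.image (·⁻¹))
  let f : (({1} : Finset G) → B) → A := fun v => (v ⟨1, by simp⟩).2
  have hf : ∀ y g, slidingBlock {1} f y g = (y g).2 := fun y g => by simp [slidingBlock, f]
  refine ⟨B, Fintype.ofFinite B, inferInstance, Set.range (itinerary β R), E', {1}, f,
    isSubshift_range_itinerary β hR, ?_, fun Z hZ hZY => ?_⟩
  · rw [← hβ, ← Set.range_comp]
    congr 1
    funext x g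
    simp [hf, itinerary, R]
  · rw [isSubshift_iff] at hZ
    have : CompactSpace Z := isCompact_iff_compactSpace.1 hZ.1.isCompact
    let s : Cantor → E' → B := fun x g => itinerary β R x g
    have hs : Continuous s := continuous_pi fun g =>
      (continuous_apply (g : G)).comp (continuous_itinerary β hR)
    obtain ⟨β', φ, hβ', hφ⟩ := exists_action_of_action (HasSeparatingBits.subtype_shift Z)
      (fun g z => ⟨shift g z.1, hZ.2 g _ z.2⟩)
      (fun g => by
        have := continuous_shift (A := B) g
        fun_prop)
      (fun z => by simp [shift_one])
      (fun g h z => by simp [shift_mul])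
      (q := fun z (g : E') => z.1 g)
      (continuous_pi fun g => (continuous_apply (g : G)).comp continuous_subtype_val) hs
      (by
        unfold patterns at hZY
        rw [← Set.range_comp, Set.image_eq_range] at hZY
        exact hZY)
    have hRφ : ∀ z c, R (φ (z, c)) = z.1 1 := by
      intro z c
      have h1 := congrFun (hφ (z, c)) ⟨1, by simp [E']⟩
      simpa only [s, itinerary, inv_one, ActSpace.map_one] using h1
    have hmem : β' ∈ {β' : ActSpace G | Set.range (itinerary β' P) = X} := by
      refine hE β' fun g hg y i hi => ?_
      obtain ⟨⟨z, c⟩, rfl⟩ := φ.surjective y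
      have h1 := hRφ ⟨shift g z.1, hZ.2 g _ z.2⟩ c
      have h2 := congrFun (hφ (z, c)) ⟨g⁻¹, by simp [E', hg]⟩
      simp only [s, itinerary, inv_inv] at h2
      have h3 : R (β'.1 g (φ (z, c))) = R (β.1 g (φ (z, c))) := by
        rw [hβ', h1, h2]
        simp [shift]
      exact congrFun (congrArg Prod.fst h3) ⟨i, hi⟩
    have hit : ∀ z c, itinerary β' P (φ (z, c)) = slidingBlock {1} f z.1 := by
      intro z c
      funext g
      have h1 := hRφ ⟨shift g⁻¹ z.1, hZ.2 g⁻¹ _ z.2⟩ c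
      rw [hf, itinerary, hβ']
      have h2 := congrArg Prod.snd h1
      simpa [R, shift] using h2
    rw [← show Set.range (itinerary β' P) = X from hmem]
    ext w
    constructor
    · rintro ⟨z, hz, rfl⟩
      exact ⟨φ (⟨z, hz⟩, fun _ _ => false), hit _ _⟩
    · rintro ⟨y, rfl⟩
      obtain ⟨⟨z, c⟩, rfl⟩ := φ.surjective y
      exact ⟨z.1, z.2, (hit z c).symm⟩

omit [DiscreteTopology A] [Finite A] [Countable G] [TopologicalSpace A] in
theorem range_itinerary_of_conj {α β : ActSpace G} {φ : Cantor ≃ₜ Cantor}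
    (h : ∀ g : G, (β.1 g : Cantor → Cantor) = φ ∘ (α.1 g : Cantor → Cantor) ∘ φ.symm)
    (P : Cantor → A) : Set.range (itinerary β P) = Set.range (itinerary α (P ∘ φ)) := by
  rw [← φ.surjective.range_comp]
  congr 1
  funext x g
  simp [itinerary, h]

omit A [TopologicalSpace A] [DiscreteTopology A] [Finite A] in
instance : BaireSpace (ActSpace G) := by
  have hcl : IsClosed {α : G → C(Cantor, Cantor) | IsAction G α} := by
    unfold IsAction
    simp only [Set.ofPred_and, Set.ofPred_forall]
    refine (isClosed_eq (by fun_prop) continuous_const).inter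
      (isClosed_iInter fun g => isClosed_iInter fun h => isClosed_eq (by fun_prop) ?_)
    exact (continuous_apply g).compCM (continuous_apply h)
  have : (uniformity Bool).IsCountablyGenerated := by
    rw [DiscreteUniformity.eq_principal_setRelId]
    infer_instance
  have : TopologicalSpace.IsCompletelyPseudoMetrizableSpace (ActSpace G) :=
    hcl.isCompletelyPseudoMetrizableSpace
  infer_instance

end Actions

/-- The locally constant map reading off a table on initial segments of length `w.1`. -/
def tableMap {A : Type} (w : Σ N : ℕ, (Fin N → Bool) → A) (x : Cantor) : A :=
  w.2 fun i => x i

theorem continuous_tableMap {A : Type} [TopologicalSpace A]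
    (w : Σ N : ℕ, (Fin N → Bool) → A) : Continuous (tableMap w) :=
  (continuous_of_discreteTopology (f := w.2)).comp (by fun_prop)

theorem exists_tableMap_eq {A : Type} [TopologicalSpace A] [DiscreteTopology A]
    {P : Cantor → A} (hP : Continuous P) : ∃ w, tableMap w = P := by
  obtain ⟨N, hN⟩ := exists_depends_on_initial_bits hP
  refine ⟨⟨N, fun v => P fun n => if h : n < N then v ⟨n, h⟩ else false⟩, funext fun x => ?_⟩
  exact hN _ _ fun i hi => by simp [hi]

/-- If for some finite alphabet `A` (with at least two elements),
some subshift `X ⊆ A^G` and some finite `F ⊆ G` no projectively isolated subshift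
has the same `F`-patterns as `X`, then every conjugacy class in `Act_G(𝒞)` is meager;
in particular `G` does not have the strong topological Rokhlin property. -/
theorem meager_classes_of_no_projIsolated (G : Type) [Group G] [Countable G]
    (A : Type) [Fintype A] [Nontrivial A]
    (X : Set (G → A)) (hX : IsSubshift G A X) (F : Finset G)
    (h : ¬ ∃ X' : Set (G → A), IsSubshift G A X' ∧ ProjIsolated G A X' ∧
      patterns F X' = patterns F X) :
    (∀ α : ActSpace G, IsMeagre (conjClass α)) ∧ ¬ HasSTRP G := by
  let _ : TopologicalSpace A := ⊥
  have : DiscreteTopology A := ⟨rfl⟩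
  have hne : X.Nonempty := by
    rw [Set.nonempty_iff_ne_empty]
    rintro rfl
    refine h ⟨∅, hX, ⟨A, inferInstance, inferInstance, ∅, ∅, ∅, fun _ => Classical.arbitrary A,
      hX, Set.image_empty _, fun Z _ hZ => ?_⟩, rfl⟩
    have : Z = ∅ := by simpa [patterns] using hZ
    rw [this, Set.image_empty]
  have hmeagre : ∀ α : ActSpace G, IsMeagre (conjClass α) := by
    intro α
    let O : Set (ActSpace G) := {β | ∃ P : Cantor → A, Continuous P ∧
      patterns F (Set.range (itinerary β P)) = patterns F X}
    have hO : IsOpen O := by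
      rw [isOpen_iff_mem_nhds]
      rintro β ⟨P, hP, hPF⟩
      filter_upwards [eventually_patterns_eq β hP F] with β' hβ'
      exact ⟨P, hP, hβ'.trans hPF⟩
    have hOc : IsMeagre Oᶜ := by
      refine IsNowhereDense.isMeagre (hO.isClosed_compl.isNowhereDense_iff.2 ?_)
      rw [interior_compl, (dense_setOf_patterns_eq hX hne F).closure_eq, Set.compl_univ]
    let T : (Σ N : ℕ, (Fin N → Bool) → A) × (Σ N : ℕ, (Fin N → Bool) → A) → Set (ActSpace G) :=
      fun w => {β | Set.range (itinerary β (tableMap w.1)) =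
          Set.range (itinerary α (tableMap w.2)) ∧
        patterns F (Set.range (itinerary α (tableMap w.2))) = patterns F X}
    have hT : ∀ w, IsMeagre (T w) := by
      intro w
      by_cases hw : patterns F (Set.range (itinerary α (tableMap w.2))) = patterns F X
      · have hsub := isSubshift_range_itinerary α (continuous_tableMap w.2)
        have hcl := isClosed_setOf_range_itinerary_eq (continuous_tableMap w.1)
          (isClosed_range_itinerary α (continuous_tableMap w.2))
        refine (IsNowhereDense.isMeagre (hcl.isNowhereDense_iff.2 ?_)).mono fun β hβ => hβ.1
        rw [Set.eq_empty_iff_forall_notMem]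
        intro β hβ
        exact h ⟨_, hsub, projIsolated_of_mem_nhds (continuous_tableMap w.1)
          (mem_interior_iff_mem_nhds.1 hβ), hw⟩
      · refine IsMeagre.empty.mono fun β hβ => hw hβ.2
    refine (hOc.union (isMeagre_iUnion hT)).mono ?_
    rintro β ⟨φ, hφ⟩
    by_cases hβ : β ∈ O
    · obtain ⟨P, hP, hPF⟩ := hβ
      obtain ⟨w, rfl⟩ := exists_tableMap_eq hP
      obtain ⟨w', hw'⟩ := exists_tableMap_eq (hP.comp φ.continuous)
      have heq := range_itinerary_of_conj hφ (tableMap w)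
      refine Or.inr (Set.mem_iUnion.2 ⟨(w, w'), ?_, ?_⟩)
      · rw [heq, hw']
      · rw [hw', ← heq, hPF]
    · exact Or.inl hβ
  refine ⟨hmeagre, fun ⟨α, hα⟩ => ?_⟩
  have : Nonempty (ActSpace G) := ⟨α⟩
  exact not_isMeagre_of_mem_residual hα (hmeagre α)
end
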